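/- Assume f, g_1, …, g_{n_X} and l_1, …, l_{n_TR} are polynomial. For every ε > 0 there exists a polynomial ψ ∈ ℝ[x₁,…,x_n,t] such that (i) u(x,t) ≤ ψ(x,t) for all (x,t) ∈ B × [0,T] and sup_{(x,t)∈B×[0,T]} |ψ(x,t) − u(x,t)| < (T+3)ε; (ii) ∂_t ψ(x,t) + ⟨∇_x ψ(x,t), f(x,d)⟩ < 0 for all (x,t,d) ∈ B × [0,T] × 𝒟; (iii) ψ(x,t) > g_i(x,t) for all (x,t) ∈ B × [0,T] and all i; (iv) ψ(x,T) > l_j(x) for all x ∈ B and all j. Consequently, there exists a sequence of polynomials ψ_k satisfying constraints (ii)–(iv) that converges to u uniformly on B × [0,T]. -/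

import Mathlib

open Set MeasureTheory RealInnerProductSpace Filter Topology

noncomputable section

abbrev EucSp (n : ℕ) : Type := EuclideanSpace ℝ (Fin n)

/-- An admissible uncertainty on `[t, T]`: a measurable map taking values in `D` there. -/
def Admissible {m : ℕ} (D : Set (EucSp m)) (t T : ℝ) (d : ℝ → EucSp m) : Prop :=
  Measurable d ∧ ∀ s ∈ Set.Icc t T, d s ∈ D

/-- `y` solves `ẏ(s) = F (y s) (d s)` on `[t, T]` with `y t = x` (integral form,
equivalent to absolute continuity together with the a.e. differential equation). -/
def IsTraj {n m : ℕ} (F : EucSp n → EucSp m → EucSp n) (d : ℝ → EucSp m)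
    (t T : ℝ) (x : EucSp n) (y : ℝ → EucSp n) : Prop :=
  y t = x ∧ ∀ s ∈ Set.Icc t T, y s = x + ∫ r in t..s, F (y r) (d r)

/-- The payoff of a trajectory `y` on `[t, T]`:
`max { max_j l_j (y T), max_i sup_{s ∈ [t,T]} g_i (y s, s) }`. -/
def payoff {n nX nTR : ℕ} (g : Fin nX → EucSp n → ℝ → ℝ) (l : Fin nTR → EucSp n → ℝ)
    (t T : ℝ) (y : ℝ → EucSp n) : ℝ :=
  max (⨆ j, l j (y T)) (⨆ i, sSup ((fun s => g i (y s) s) '' Set.Icc t T))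

/-- The defining property of the value function `u`: for `(x, t) ∈ ℝⁿ × [0, T]`,
`u (x, t)` is the supremum of the payoffs over all admissible uncertainties on `[t, T]`
(the trajectory being the unique solution of the ODE driven by the uncertainty). -/
def IsValueFun {n m nX nTR : ℕ} (F : EucSp n → EucSp m → EucSp n) (D : Set (EucSp m))
    (g : Fin nX → EucSp n → ℝ → ℝ) (l : Fin nTR → EucSp n → ℝ) (T : ℝ)
    (u : EucSp n → ℝ → ℝ) : Prop :=
  ∀ x : EucSp n, ∀ t ∈ Set.Icc (0:ℝ) T,
    u x t = sSup {r | ∃ d y, Admissible D t T d ∧ IsTraj F d t T x y ∧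
      r = payoff g l t T y}

/-- The Hamiltonian `H(x, p) = max_{d ∈ D} ⟪p, F x d⟫`. -/
def Ham {n m : ℕ} (F : EucSp n → EucSp m → EucSp n) (D : Set (EucSp m))
    (x p : EucSp n) : ℝ :=
  sSup ((fun d => ⟪p, F x d⟫) '' D)

/-- Viscosity super-solution of `max{∂ₜ w + H(x, ∇ₓ w), maxᵢ gᵢ(x,t) - w} = 0` on
`ℝⁿ × [0, T]`: a lower semicontinuous function such that for every smooth test function
`ψ` such that `w - ψ` attains a local minimum at `(x₀, t₀) ∈ ℝⁿ × [0, T]`, one has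
`max{∂ₜ ψ(x₀,t₀) + H(x₀, ∇ₓ ψ(x₀,t₀)), maxᵢ gᵢ(x₀,t₀) - w(x₀,t₀)} ≤ 0`. -/
def ViscSuper {n m nX : ℕ} (F : EucSp n → EucSp m → EucSp n) (D : Set (EucSp m))
    (g : Fin nX → EucSp n → ℝ → ℝ) (T : ℝ) (w : EucSp n → ℝ → ℝ) : Prop :=
  LowerSemicontinuousOn (fun p : EucSp n × ℝ => w p.1 p.2) (Set.univ ×ˢ Set.Icc 0 T) ∧
  ∀ ψ : EucSp n → ℝ → ℝ, ContDiff ℝ (⊤ : ℕ∞) (fun p : EucSp n × ℝ => ψ p.1 p.2) →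
    ∀ x₀ : EucSp n, ∀ t₀ ∈ Set.Icc (0:ℝ) T,
      IsLocalMinOn (fun p : EucSp n × ℝ => w p.1 p.2 - ψ p.1 p.2)
        (Set.univ ×ˢ Set.Icc 0 T) (x₀, t₀) →
      max (deriv (ψ x₀) t₀ + Ham F D x₀ (gradient (fun z => ψ z t₀) x₀))
        ((⨆ i, g i x₀ t₀) - w x₀ t₀) ≤ 0

/-- Viscosity sub-solution of `max{∂ₜ w + H(x, ∇ₓ w), maxᵢ gᵢ(x,t) - w} = 0` on
`ℝⁿ × [0, T]`. -/
def ViscSub {n m nX : ℕ} (F : EucSp n → EucSp m → EucSp n) (D : Set (EucSp m))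
    (g : Fin nX → EucSp n → ℝ → ℝ) (T : ℝ) (w : EucSp n → ℝ → ℝ) : Prop :=
  UpperSemicontinuousOn (fun p : EucSp n × ℝ => w p.1 p.2) (Set.univ ×ˢ Set.Icc 0 T) ∧
  ∀ ψ : EucSp n → ℝ → ℝ, ContDiff ℝ (⊤ : ℕ∞) (fun p : EucSp n × ℝ => ψ p.1 p.2) →
    ∀ x₀ : EucSp n, ∀ t₀ ∈ Set.Icc (0:ℝ) T,
      IsLocalMaxOn (fun p : EucSp n × ℝ => w p.1 p.2 - ψ p.1 p.2)
        (Set.univ ×ˢ Set.Icc 0 T) (x₀, t₀) →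
      0 ≤ max (deriv (ψ x₀) t₀ + Ham F D x₀ (gradient (fun z => ψ z t₀) x₀))
        ((⨆ i, g i x₀ t₀) - w x₀ t₀)

/-- The backward reachable set at time `t` (horizon `T`) of the target `{maxⱼ lⱼ ≤ 0}`
under state constraints `{maxᵢ gᵢ(·, s) ≤ 0}`, for the dynamics `f` driven by
uncertainties in `D`: the set of `x` such that for every admissible uncertainty the
(unique) solution extends to all of `[t, T]`, respects the state constraints there,
and ends up in the target at time `T`. -/
def Reach {n m nX nTR : ℕ} (f : EucSp n → EucSp m → EucSp n) (D : Set (EucSp m))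
    (g : Fin nX → EucSp n → ℝ → ℝ) (l : Fin nTR → EucSp n → ℝ)
    (t T : ℝ) : Set (EucSp n) :=
  {x | ∀ d, Admissible D t T d → ∃ y, IsTraj f d t T x y ∧
    (∀ s ∈ Set.Icc t T, ∀ i, g i (y s) s ≤ 0) ∧ ∀ j, l j (y T) ≤ 0}

/-- `ψ : ℝⁿ × ℝ → ℝ` is (the evaluation of) a polynomial in `x₁, …, xₙ, t`. -/
def IsPolyFun {n : ℕ} (ψ : EucSp n → ℝ → ℝ) : Prop :=
  ∃ p : MvPolynomial (Fin n ⊕ Unit) ℝ,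
    ∀ (x : EucSp n) (t : ℝ),
      ψ x t = MvPolynomial.eval (Sum.elim (fun k => x k) (fun _ => t)) p

section Trajectories

lemma integral_exp_weight_le {L : ℝ} (hL : 0 ≤ L) (t s : ℝ) :
    ∫ r in t..s, L * Real.exp ((2 * L + 1) * (r - t)) ≤
      1 / 2 * Real.exp ((2 * L + 1) * (s - t)) := by
  have hpos : (0 : ℝ) < 2 * L + 1 := by positivity
  have hder : ∀ r ∈ uIcc t s, HasDerivAt
      (fun r => L / (2 * L + 1) * Real.exp ((2 * L + 1) * (r - t)))
      (L * Real.exp ((2 * L + 1) * (r - t))) r := by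
    intro r _
    have h := ((((hasDerivAt_id r).sub_const t).const_mul (2 * L + 1)).exp).const_mul
      (L / (2 * L + 1))
    exact h.congr_deriv (by simp only [id]; field_simp)
  rw [intervalIntegral.integral_eq_sub_of_hasDerivAt hder
    (Continuous.intervalIntegrable (by fun_prop) _ _)]
  have h1 : L / (2 * L + 1) ≤ 1 / 2 := by
    rw [div_le_div_iff₀ hpos (by norm_num)]; linarith
  have h2 : 0 ≤ L / (2 * L + 1) := by positivity
  have h3 := Real.exp_pos ((2 * L + 1) * (s - t))
  have h4 := Real.exp_pos ((2 * L + 1) * (t - t))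
  nlinarith

/-- An integral form of Grönwall's inequality (with non-optimal constants). -/
lemma gronwall_integral {L A t T : ℝ} (hL : 0 ≤ L) {a : ℝ → ℝ}
    (hcont : ContinuousOn a (Icc t T)) (ha0 : ∀ s ∈ Icc t T, 0 ≤ a s)
    (ha : ∀ s ∈ Icc t T, a s ≤ A + ∫ r in t..s, L * a r) :
    ∀ s ∈ Icc t T, a s ≤ 2 * A * Real.exp ((2 * L + 1) * (s - t)) := by
  intro s hs
  obtain ⟨s₁, hs₁, hmax⟩ := isCompact_Icc.exists_isMaxOn (s := Icc t T) ⟨s, hs⟩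
    (f := fun s => a s * Real.exp (-((2 * L + 1) * (s - t)))) (by fun_prop)
  set M := a s₁ * Real.exp (-((2 * L + 1) * (s₁ - t))) with hM
  have hle : ∀ r ∈ Icc t T, a r ≤ M * Real.exp ((2 * L + 1) * (r - t)) := by
    intro r hr
    have h : a r * Real.exp (-((2 * L + 1) * (r - t))) ≤ M := hmax hr
    rw [Real.exp_neg, ← div_eq_mul_inv, div_le_iff₀ (Real.exp_pos _)] at h
    exact h
  have hM0 : 0 ≤ M := mul_nonneg (ha0 _ hs₁) (Real.exp_pos _).le
  have hA : 0 ≤ A := by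
    have htT : t ∈ Icc t T := ⟨le_rfl, hs.1.trans hs.2⟩
    have := ha t htT
    have h0 := ha0 t htT
    simp at this
    linarith
  have hint : ∫ r in t..s₁, L * a r ≤ M * (1 / 2 * Real.exp ((2 * L + 1) * (s₁ - t))) := by
    calc ∫ r in t..s₁, L * a r
        ≤ ∫ r in t..s₁, M * (L * Real.exp ((2 * L + 1) * (r - t))) := by
          apply intervalIntegral.integral_mono_on hs₁.1
          · apply ContinuousOn.intervalIntegrable
            rw [uIcc_of_le hs₁.1]
            exact continuousOn_const.mul (hcont.mono (Icc_subset_Icc_right hs₁.2))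
          · exact Continuous.intervalIntegrable (by fun_prop) _ _
          · intro r hr
            have := hle r ⟨hr.1, hr.2.trans hs₁.2⟩
            nlinarith
      _ = M * ∫ r in t..s₁, L * Real.exp ((2 * L + 1) * (r - t)) := by
          rw [intervalIntegral.integral_const_mul]
      _ ≤ _ := mul_le_mul_of_nonneg_left (integral_exp_weight_le hL _ _) hM0
  have hexp1 : 1 ≤ Real.exp ((2 * L + 1) * (s₁ - t)) :=
    Real.one_le_exp (mul_nonneg (by positivity) (sub_nonneg.2 hs₁.1))
  have hM2 : M ≤ 2 * A := by
    have h1 := ha s₁ hs₁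
    have h2 : a s₁ = M * Real.exp ((2 * L + 1) * (s₁ - t)) := by
      rw [hM, mul_assoc, ← Real.exp_add]; simp
    nlinarith
  exact (hle s hs).trans (mul_le_mul_of_nonneg_right hM2 (Real.exp_pos _).le)

variable {n m : ℕ} {F : EucSp n → EucSp m → EucSp n} {D : Set (EucSp m)}

lemma norm_le_linear_growth {L C : ℝ} (hLC : L ≤ C) (hC : ∀ d ∈ D, ‖F 0 d‖ ≤ C)
    (hFlip : ∀ x y : EucSp n, ∀ d ∈ D, ‖F x d - F y d‖ ≤ L * ‖x - y‖) :
    ∀ x, ∀ d ∈ D, ‖F x d‖ ≤ C * (‖x‖ + 1) := by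
  intro x d hd
  have h1 := hFlip x 0 d hd
  have h2 := norm_add_le (F x d - F 0 d) (F 0 d)
  rw [sub_add_cancel] at h2
  rw [sub_zero] at h1
  nlinarith [hC d hd, norm_nonneg x]

lemma IsTraj.continuousOn_of_integrable {d : ℝ → EucSp m} {t T : ℝ} {x : EucSp n}
    {y : ℝ → EucSp n} (hy : IsTraj F d t T x y) {s : ℝ} (hs : s ∈ Icc t T)
    (hint : IntervalIntegrable (fun r => F (y r) (d r)) volume t s) :
    ContinuousOn y (Icc t s) := by
  have h := intervalIntegral.continuousOn_primitive_interval (a := t) (b := s)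
    (f := fun r => F (y r) (d r)) (μ := volume)
    (by rw [uIcc_of_le hs.1]; exact (intervalIntegrable_iff_integrableOn_Icc_of_le hs.1).1 hint)
  rw [uIcc_of_le hs.1] at h
  exact (continuousOn_const.add h).congr
    fun r hr => hy.2 r ⟨hr.1, hr.2.trans hs.2⟩

lemma IsTraj.norm_le_of_integrable {C : ℝ} (hC0 : 0 ≤ C)
    (hgrow : ∀ x, ∀ d ∈ D, ‖F x d‖ ≤ C * (‖x‖ + 1))
    {d : ℝ → EucSp m} {t T : ℝ} (hd : Admissible D t T d) {x : EucSp n}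
    {y : ℝ → EucSp n} (hy : IsTraj F d t T x y) {s : ℝ} (hs : s ∈ Icc t T)
    (hint : IntervalIntegrable (fun r => F (y r) (d r)) volume t s) :
    ‖y s‖ ≤ 2 * (‖x‖ + 1) * Real.exp ((2 * C + 1) * (s - t)) := by
  have hc := hy.continuousOn_of_integrable hs hint
  have hg := gronwall_integral (L := C) (A := ‖x‖ + 1) (t := t) (T := s)
    (a := fun r => ‖y r‖ + 1) hC0 (by fun_prop) (fun r _ => by positivity) ?_ s ⟨hs.1, le_rfl⟩
  · linarith
  · intro r hr
    have hrT : r ∈ Icc t T := ⟨hr.1, hr.2.trans hs.2⟩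
    have h1 : ‖∫ q in t..r, F (y q) (d q)‖ ≤ ∫ q in t..r, C * (‖y q‖ + 1) := by
      apply intervalIntegral.norm_integral_le_of_norm_le hr.1
      · refine ae_of_all _ fun q hq => hgrow _ _ (hd.2 q ⟨hq.1.le, hq.2.trans hrT.2⟩)
      · apply ContinuousOn.intervalIntegrable
        rw [uIcc_of_le hr.1]
        have := hc.mono (Icc_subset_Icc_right hr.2)
        fun_prop
    have h2 : ‖y r‖ ≤ ‖x‖ + ‖∫ q in t..r, F (y q) (d q)‖ := by
      rw [hy.2 r hrT]; exact norm_add_le _ _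
    linarith

lemma Admissible.integrable_comp
    (hFcont : Continuous fun p : EucSp n × EucSp m => F p.1 p.2) {C : ℝ} (hC0 : 0 ≤ C)
    (hgrow : ∀ x, ∀ d ∈ D, ‖F x d‖ ≤ C * (‖x‖ + 1))
    {d : ℝ → EucSp m} {t T : ℝ} (htT : t ≤ T) (hd : Admissible D t T d)
    {y : ℝ → EucSp n} {b : ℝ}
    (hmeas : AEStronglyMeasurable y (volume.restrict (Ioc t T)))
    (hb : ∀ s ∈ Icc t T, ‖y s‖ ≤ b) :
    IntervalIntegrable (fun r => F (y r) (d r)) volume t T := by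
  rw [intervalIntegrable_iff_integrableOn_Ioc_of_le htT]
  have hm : AEStronglyMeasurable (fun r => F (y r) (d r)) (volume.restrict (Ioc t T)) :=
    hFcont.comp_aestronglyMeasurable (hmeas.prodMk hd.1.aestronglyMeasurable)
  refine Integrable.of_bound hm (C * (b + 1)) ?_
  filter_upwards [ae_restrict_mem measurableSet_Ioc] with r hr
  have hr' : r ∈ Icc t T := Ioc_subset_Icc_self hr
  have := hgrow (y r) (d r) (hd.2 r hr')
  have hbr := hb r hr'
  nlinarith [hbr]

/-- The integrand of a trajectory is automatically integrable, and the trajectory is bounded. -/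
lemma IsTraj.integrable_and_norm_le
    (hFcont : Continuous fun p : EucSp n × EucSp m => F p.1 p.2) {C : ℝ} (hC0 : 0 ≤ C)
    (hgrow : ∀ x, ∀ d ∈ D, ‖F x d‖ ≤ C * (‖x‖ + 1))
    {d : ℝ → EucSp m} {t T : ℝ} (htT : t ≤ T) (hd : Admissible D t T d) {x : EucSp n}
    {y : ℝ → EucSp n} (hy : IsTraj F d t T x y) :
    IntervalIntegrable (fun r => F (y r) (d r)) volume t T ∧
      ∀ s ∈ Icc t T, ‖y s‖ ≤ 2 * (‖x‖ + 1) * Real.exp ((2 * C + 1) * (s - t)) := by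
  set f : ℝ → EucSp n := fun r => F (y r) (d r) with hf
  have hbound : ∀ s ∈ Icc t T, ‖y s‖ ≤ 2 * (‖x‖ + 1) * Real.exp ((2 * C + 1) * (s - t)) := by
    intro s hs
    by_cases h : IntervalIntegrable f volume t s
    · exact hy.norm_le_of_integrable hC0 hgrow hd hs h
    · rw [hy.2 s hs, intervalIntegral.integral_undef h, add_zero]
      have : 1 ≤ Real.exp ((2 * C + 1) * (s - t)) :=
        Real.one_le_exp (mul_nonneg (by positivity) (sub_nonneg.2 hs.1))
      nlinarith [norm_nonneg x]
  refine ⟨?_, hbound⟩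
  set S : Set ℝ := {s | s ∈ Icc t T ∧ IntervalIntegrable f volume t s} with hS
  have htS : t ∈ S := ⟨⟨le_rfl, htT⟩, by simp⟩
  have hSb : BddAbove S := ⟨T, fun s hs => hs.1.2⟩
  set σ := sSup S with hσ
  have hσt : t ≤ σ := le_csSup hSb htS
  have hσT : σ ≤ T := csSup_le ⟨t, htS⟩ fun s hs => hs.1.2
  have hbelow : ContinuousOn y (Ioo t σ) := by
    intro r hr
    obtain ⟨s, hsS, hrs⟩ := exists_lt_of_lt_csSup ⟨t, htS⟩ hr.2
    have h := hy.continuousOn_of_integrable hsS.1 hsS.2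
    exact ((h r ⟨hr.1.le, hrs.le⟩).continuousAt (Icc_mem_nhds hr.1 hrs)).continuousWithinAt
  have habove : ∀ r ∈ Ioc σ T, y r = x := by
    intro r hr
    have hrT : r ∈ Icc t T := ⟨hσt.trans hr.1.le, hr.2⟩
    have h : ¬ IntervalIntegrable f volume t r := fun h =>
      absurd (le_csSup hSb (show r ∈ S from ⟨hrT, h⟩)) (not_le.2 hr.1)
    rw [hy.2 r hrT, intervalIntegral.integral_undef h, add_zero]
  have hm : AEStronglyMeasurable y (volume.restrict (Ioc t T)) := by
    rw [← Ioc_union_Ioc_eq_Ioc hσt hσT, aestronglyMeasurable_union_iff]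
    constructor
    · rw [← restrict_Ioo_eq_restrict_Ioc]
      exact hbelow.aestronglyMeasurable measurableSet_Ioo
    · refine (aestronglyMeasurable_const (b := x)).congr ?_
      filter_upwards [ae_restrict_mem measurableSet_Ioc] with r hr
      exact (habove r hr).symm
  refine hd.integrable_comp hFcont hC0 hgrow htT hm
    (b := 2 * (‖x‖ + 1) * Real.exp ((2 * C + 1) * (T - t))) fun s hs => (hbound s hs).trans ?_
  have := hs.2
  gcongr

lemma IsTraj.continuousOn
    (hFcont : Continuous fun p : EucSp n × EucSp m => F p.1 p.2) {C : ℝ} (hC0 : 0 ≤ C)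
    (hgrow : ∀ x, ∀ d ∈ D, ‖F x d‖ ≤ C * (‖x‖ + 1))
    {d : ℝ → EucSp m} {t T : ℝ} (htT : t ≤ T) (hd : Admissible D t T d) {x : EucSp n}
    {y : ℝ → EucSp n} (hy : IsTraj F d t T x y) : ContinuousOn y (Icc t T) :=
  hy.continuousOn_of_integrable ⟨htT, le_rfl⟩
    (hy.integrable_and_norm_le hFcont hC0 hgrow htT hd).1

/-- Carathéodory existence: every admissible uncertainty drives a trajectory. -/
lemma exists_isTraj
    (hFcont : Continuous fun p : EucSp n × EucSp m => F p.1 p.2) {C : ℝ} (hC0 : 0 ≤ C)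
    (hgrow : ∀ x, ∀ d ∈ D, ‖F x d‖ ≤ C * (‖x‖ + 1)) {L : ℝ} (hL : 0 ≤ L)
    (hFlip : ∀ x y : EucSp n, ∀ d ∈ D, ‖F x d - F y d‖ ≤ L * ‖x - y‖)
    {d : ℝ → EucSp m} {t T : ℝ} (htT : t ≤ T) (hd : Admissible D t T d) (x : EucSp n) :
    ∃ y, IsTraj F d t T x y := by
  set e : ℝ → ℝ := fun r => Real.exp ((2 * L + 1) * (r - t)) with he
  have hec : Continuous e := by fun_prop
  have hepos : ∀ r, 0 < e r := fun r => Real.exp_pos _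
  set Y : C(Icc t T, EucSp n) → ℝ → EucSp n := fun z r => e r • IccExtend htT z r with hY
  have hYc : ∀ z, Continuous (Y z) := fun z => hec.smul (z.continuous.Icc_extend')
  have hint : ∀ z, IntervalIntegrable (fun r => F (Y z r) (d r)) volume t T := by
    intro z
    obtain ⟨b, hb⟩ := isCompact_Icc.exists_bound_of_continuousOn (s := Icc t T)
      (hYc z).continuousOn
    exact hd.integrable_comp hFcont hC0 hgrow htT (hYc z).aestronglyMeasurable hb
  have hint' : ∀ z, ∀ s ∈ Icc t T, IntervalIntegrable (fun r => F (Y z r) (d r)) volume t s :=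
    fun z s hs => (hint z).mono_set (by
      rw [uIcc_of_le htT, uIcc_of_le hs.1]; exact Icc_subset_Icc_right hs.2)
  have hprim : ∀ z, ContinuousOn (fun s => ∫ r in t..s, F (Y z r) (d r)) (Icc t T) := by
    intro z
    have h := intervalIntegral.continuousOn_primitive_interval (a := t) (b := T)
      (f := fun r => F (Y z r) (d r)) (μ := volume) (by
        rw [uIcc_of_le htT]
        exact (intervalIntegrable_iff_integrableOn_Icc_of_le htT).1 (hint z))
    rwa [uIcc_of_le htT] at h
  let Φ : C(Icc t T, EucSp n) → C(Icc t T, EucSp n) := fun z =>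
    ⟨fun s => (e s)⁻¹ • (x + ∫ r in t..(s : ℝ), F (Y z r) (d r)), by
      refine Continuous.smul ((hec.comp continuous_subtype_val).inv₀ fun s => (hepos _).ne') ?_
      exact continuous_const.add (continuousOn_iff_continuous_domRestrict.1 (hprim z))⟩
  have hΦ : ContractingWith (1 / 2) Φ := by
    refine ⟨by
      rw [← NNReal.coe_lt_coe]; norm_num, LipschitzWith.of_dist_le_mul fun z w => ?_⟩
    rw [ContinuousMap.dist_le (by positivity)]
    intro s
    have hval : dist (Φ z s) (Φ w s) =
        (e s)⁻¹ * ‖∫ r in t..(s : ℝ), (F (Y z r) (d r) - F (Y w r) (d r))‖ := by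
      rw [intervalIntegral.integral_sub (hint' z s s.2) (hint' w s s.2)]
      change dist ((e s)⁻¹ • (x + _)) ((e s)⁻¹ • (x + _)) = _
      rw [dist_eq_norm, ← smul_sub, norm_smul, add_sub_add_left_eq_sub, Real.norm_of_nonneg
        (inv_nonneg.2 (hepos _).le)]
    have hle : ‖∫ r in t..(s : ℝ), (F (Y z r) (d r) - F (Y w r) (d r))‖ ≤
        ∫ r in t..(s : ℝ), dist z w * (L * e r) := by
      apply intervalIntegral.norm_integral_le_of_norm_le s.2.1
      · refine ae_of_all _ fun r hr => ?_
        have hrT : r ∈ Icc t T := ⟨hr.1.le, hr.2.trans s.2.2⟩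
        refine (hFlip _ _ _ (hd.2 r hrT)).trans ?_
        rw [hY]
        simp only
        rw [← smul_sub, norm_smul, Real.norm_of_nonneg (hepos r).le, IccExtend_of_mem _ _ hrT,
          IccExtend_of_mem _ _ hrT, ← dist_eq_norm]
        have h1 := ContinuousMap.dist_apply_le_dist (f := z) (g := w) ⟨r, hrT⟩
        have h2 : 0 ≤ L * e r := mul_nonneg hL (hepos r).le
        nlinarith
      · exact Continuous.intervalIntegrable (by fun_prop) _ _
    rw [hval]
    rw [intervalIntegral.integral_const_mul] at hle
    have h3 := integral_exp_weight_le hL t s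
    rw [inv_mul_le_iff₀ (hepos _)]
    refine hle.trans ?_
    have h4 : dist z w * ∫ r in t..(s : ℝ), L * e r ≤ dist z w * (1 / 2 * e s) :=
      mul_le_mul_of_nonneg_left h3 dist_nonneg
    refine h4.trans (le_of_eq ?_)
    push_cast
    ring
  have hfix := hΦ.fixedPoint_isFixedPt
  set z := ContractingWith.fixedPoint Φ hΦ
  have hsol : ∀ s ∈ Icc t T, Y z s = x + ∫ r in t..s, F (Y z r) (d r) := by
    intro s hs
    have h1 : Y z s = e s • z ⟨s, hs⟩ := by
      rw [hY]; simp only; rw [IccExtend_of_mem _ _ hs]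
    have h2 : z ⟨s, hs⟩ = (e s)⁻¹ • (x + ∫ r in t..s, F (Y z r) (d r)) := by
      conv_lhs => rw [← hfix.eq]
      rfl
    rw [h1, h2, smul_smul, mul_inv_cancel₀ (hepos s).ne', one_smul]
  exact ⟨Y z, by simpa using hsol t ⟨le_rfl, htT⟩, hsol⟩

end Trajectories

section Dynamics

variable {n m : ℕ} {F : EucSp n → EucSp m → EucSp n} {D : Set (EucSp m)}

lemma Admissible.mono {d : ℝ → EucSp m} {t t' T : ℝ} (hd : Admissible D t T d) (h : t ≤ t') :
    Admissible D t' T d :=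
  ⟨hd.1, fun s hs => hd.2 s ⟨h.trans hs.1, hs.2⟩⟩

lemma admissible_const {d₀ : EucSp m} (h : d₀ ∈ D) (t T : ℝ) :
    Admissible D t T fun _ => d₀ :=
  ⟨measurable_const, fun _ _ => h⟩

lemma IsTraj.eq_add_integral {d : ℝ → EucSp m} {t T : ℝ} {x : EucSp n} {y : ℝ → EucSp n}
    (hy : IsTraj F d t T x y) (hint : IntervalIntegrable (fun r => F (y r) (d r)) volume t T)
    {s s' : ℝ} (hs : t ≤ s) (hss' : s ≤ s') (hs' : s' ≤ T) :
    y s' = y s + ∫ r in s..s', F (y r) (d r) := by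
  have htT : t ≤ T := hs.trans (hss'.trans hs')
  rw [hy.2 s' ⟨hs.trans hss', hs'⟩, hy.2 s ⟨hs, hss'.trans hs'⟩, add_assoc,
    intervalIntegral.integral_add_adjacent_intervals]
  · refine hint.mono_set ?_
    rw [uIcc_of_le htT, uIcc_of_le hs]; exact Icc_subset_Icc_right (hss'.trans hs')
  · refine hint.mono_set ?_
    rw [uIcc_of_le htT, uIcc_of_le hss']; exact Icc_subset_Icc hs hs'

lemma IsTraj.restrict {d : ℝ → EucSp m} {t T : ℝ} {x : EucSp n} {y : ℝ → EucSp n}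
    (hy : IsTraj F d t T x y) (hint : IntervalIntegrable (fun r => F (y r) (d r)) volume t T)
    {t' : ℝ} (ht' : t ≤ t') : IsTraj F d t' T (y t') y :=
  ⟨rfl, fun _ hs => hy.eq_add_integral hint ht' hs.1 hs.2⟩

lemma Admissible.concat {d₁ d₂ : ℝ → EucSp m} {t t' T : ℝ} (hd₁ : Admissible D t T d₁)
    (hd₂ : Admissible D t' T d₂) : Admissible D t T fun r => if r ≤ t' then d₁ r else d₂ r := by
  refine ⟨Measurable.ite measurableSet_Iic hd₁.1 hd₂.1, fun s hs => ?_⟩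
  dsimp only
  split_ifs with h
  · exact hd₁.2 s hs
  · exact hd₂.2 s ⟨(not_le.1 h).le, hs.2⟩

lemma IsTraj.concat {d₁ d₂ : ℝ → EucSp m} {t t' T : ℝ} {x : EucSp n} {y₁ y₂ : ℝ → EucSp n}
    (htt' : t ≤ t') (ht'T : t' ≤ T)
    (hy₁ : IsTraj F d₁ t T x y₁) (hy₂ : IsTraj F d₂ t' T (y₁ t') y₂)
    (hint₁ : IntervalIntegrable (fun r => F (y₁ r) (d₁ r)) volume t T)
    (hint₂ : IntervalIntegrable (fun r => F (y₂ r) (d₂ r)) volume t' T) :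
    IsTraj F (fun r => if r ≤ t' then d₁ r else d₂ r) t T x
      (fun r => if r ≤ t' then y₁ r else y₂ r) := by
  have hleft : ∀ s ∈ Icc t t', ∀ r ∈ uIoc t s,
      F (if r ≤ t' then y₁ r else y₂ r) (if r ≤ t' then d₁ r else d₂ r) = F (y₁ r) (d₁ r) := by
    intro s hs r hr
    rw [uIoc_of_le hs.1] at hr
    rw [if_pos (hr.2.trans hs.2), if_pos (hr.2.trans hs.2)]
  have hright : ∀ s, t' ≤ s → ∀ r ∈ uIoc t' s,
      F (if r ≤ t' then y₁ r else y₂ r) (if r ≤ t' then d₁ r else d₂ r) = F (y₂ r) (d₂ r) := by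
    intro s hs r hr
    rw [uIoc_of_le hs] at hr
    rw [if_neg (not_le.2 hr.1), if_neg (not_le.2 hr.1)]
  refine ⟨by simp only [if_pos htt', hy₁.1], fun s hs => ?_⟩
  dsimp only
  split_ifs with h
  · rw [hy₁.2 s hs, intervalIntegral.integral_congr_ae
      (ae_of_all _ (hleft s ⟨hs.1, h⟩))]
  · have hs' : t' ≤ s := (not_le.1 h).le
    have hi₁ : IntervalIntegrable (fun r => F (y₁ r) (d₁ r)) volume t t' := hint₁.mono_set (by
      rw [uIcc_of_le htt', uIcc_of_le (htt'.trans ht'T)]; exact Icc_subset_Icc_right ht'T)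
    have hi₂ : IntervalIntegrable (fun r => F (y₂ r) (d₂ r)) volume t' s := hint₂.mono_set (by
      rw [uIcc_of_le hs', uIcc_of_le ht'T]; exact Icc_subset_Icc_right hs.2)
    rw [← intervalIntegral.integral_add_adjacent_intervals (b := t')
      (hi₁.congr fun r hr => (hleft t' ⟨htt', le_rfl⟩ r hr).symm)
      (hi₂.congr fun r hr => (hright s hs' r hr).symm),
      intervalIntegral.integral_congr_ae (ae_of_all _ (hleft t' ⟨htt', le_rfl⟩)),
      intervalIntegral.integral_congr_ae (ae_of_all _ (hright s hs')),
      ← add_assoc, ← hy₁.2 t' ⟨htt', ht'T⟩, ← hy₂.2 s ⟨hs', hs.2⟩]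

/-- Continuous dependence of trajectories on the initial state. -/
lemma IsTraj.norm_sub_le {L : ℝ} (hL : 0 ≤ L)
    (hFlip : ∀ x y : EucSp n, ∀ d ∈ D, ‖F x d - F y d‖ ≤ L * ‖x - y‖)
    {d : ℝ → EucSp m} {t T : ℝ} (htT : t ≤ T) (hd : Admissible D t T d) {x₁ x₂ : EucSp n}
    {y₁ y₂ : ℝ → EucSp n} (hy₁ : IsTraj F d t T x₁ y₁) (hy₂ : IsTraj F d t T x₂ y₂)
    (hint₁ : IntervalIntegrable (fun r => F (y₁ r) (d r)) volume t T)
    (hint₂ : IntervalIntegrable (fun r => F (y₂ r) (d r)) volume t T) :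
    ∀ s ∈ Icc t T, ‖y₁ s - y₂ s‖ ≤ 2 * ‖x₁ - x₂‖ * Real.exp ((2 * L + 1) * (s - t)) := by
  have hTT : T ∈ Icc t T := ⟨htT, le_rfl⟩
  have hc₁ := hy₁.continuousOn_of_integrable hTT hint₁
  have hc₂ := hy₂.continuousOn_of_integrable hTT hint₂
  refine gronwall_integral hL (by fun_prop) (fun _ _ => norm_nonneg _) fun s hs => ?_
  have hsub : uIcc t s ⊆ uIcc t T := by
    rw [uIcc_of_le hs.1, uIcc_of_le htT]; exact Icc_subset_Icc_right hs.2
  have heq : y₁ s - y₂ s = (x₁ - x₂) + ∫ r in t..s, (F (y₁ r) (d r) - F (y₂ r) (d r)) := by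
    rw [intervalIntegral.integral_sub (hint₁.mono_set hsub) (hint₂.mono_set hsub),
      hy₁.2 s hs, hy₂.2 s hs]
    abel
  have hle : ‖∫ r in t..s, (F (y₁ r) (d r) - F (y₂ r) (d r))‖ ≤
      ∫ r in t..s, L * ‖y₁ r - y₂ r‖ := by
    apply intervalIntegral.norm_integral_le_of_norm_le hs.1
    · exact ae_of_all _ fun r hr => hFlip _ _ _ (hd.2 r ⟨hr.1.le, hr.2.trans hs.2⟩)
    · apply ContinuousOn.intervalIntegrable
      rw [uIcc_of_le hs.1]
      have h₁ := hc₁.mono (Icc_subset_Icc_right hs.2)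
      have h₂ := hc₂.mono (Icc_subset_Icc_right hs.2)
      fun_prop
  rw [heq]
  exact (norm_add_le _ _).trans (by gcongr)

/-- A trajectory with speed at most `M` moves by at most `M (s' - s)`. -/
lemma IsTraj.norm_sub_le_of_speed {d : ℝ → EucSp m} {t T M : ℝ} {x : EucSp n}
    {y : ℝ → EucSp n} (hy : IsTraj F d t T x y)
    (hM : ∀ s ∈ Icc t T, ‖F (y s) (d s)‖ ≤ M) {s : ℝ} (hs : s ∈ Icc t T) :
    ‖y s - x‖ ≤ M * (s - t) := by
  rw [hy.2 s hs, add_sub_cancel_left]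
  have := intervalIntegral.norm_integral_le_of_norm_le_const (a := t) (b := s) (C := M)
    (f := fun r => F (y r) (d r)) fun r hr => by
      rw [uIoc_of_le hs.1] at hr
      exact hM r ⟨hr.1.le, hr.2.trans hs.2⟩
  rwa [abs_of_nonneg (sub_nonneg.2 hs.1)] at this

/-- First-order expansion of a trajectory driven by a constant uncertainty. -/
lemma IsTraj.norm_sub_sub_smul_le {L : ℝ} (hL : 0 ≤ L)
    (hFlip : ∀ x y : EucSp n, ∀ d ∈ D, ‖F x d - F y d‖ ≤ L * ‖x - y‖)
    {d₀ : EucSp m} (hd₀ : d₀ ∈ D) {t T M : ℝ} {x : EucSp n}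
    {y : ℝ → EucSp n} (hy : IsTraj F (fun _ => d₀) t T x y)
    (hint : IntervalIntegrable (fun r => F (y r) d₀) volume t T)
    (hM : ∀ s ∈ Icc t T, ‖F (y s) d₀‖ ≤ M) {h : ℝ} (hh : 0 ≤ h) (hhT : t + h ≤ T) :
    ‖y (t + h) - x - h • F x d₀‖ ≤ L * M * h * h := by
  have hs : t + h ∈ Icc t T := ⟨by linarith, hhT⟩
  have hint' : IntervalIntegrable (fun r => F (y r) d₀) volume t (t + h) := hint.mono_set (by
    rw [uIcc_of_le hs.1, uIcc_of_le (hs.1.trans hhT)]; exact Icc_subset_Icc_right hhT)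
  have heq : y (t + h) - x - h • F x d₀ = ∫ r in t..t + h, (F (y r) d₀ - F x d₀) := by
    rw [intervalIntegral.integral_sub hint' (by simp), hy.2 _ hs, intervalIntegral.integral_const]
    simp
  rw [heq]
  have := intervalIntegral.norm_integral_le_of_norm_le_const (a := t) (b := t + h)
    (C := L * M * h) (f := fun r => F (y r) d₀ - F x d₀) fun r hr => by
      rw [uIoc_of_le hs.1] at hr
      have hr' : r ∈ Icc t T := ⟨hr.1.le, hr.2.trans hhT⟩
      have h1 := hy.norm_sub_le_of_speed hM hr'
      have hM0 : 0 ≤ M := (norm_nonneg _).trans (hM r hr')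
      calc ‖F (y r) d₀ - F x d₀‖ ≤ L * ‖y r - x‖ := hFlip _ _ _ hd₀
        _ ≤ L * (M * h) := by
          refine mul_le_mul_of_nonneg_left (h1.trans ?_) hL
          refine mul_le_mul_of_nonneg_left ?_ hM0
          linarith [hr.2]
        _ = L * M * h := by ring
  rwa [add_sub_cancel_left, abs_of_nonneg hh] at this

end Dynamics

section ValueFunction

/-- The value function, with the initial time ranging over all of `ℝ`. -/
def valueFn {n m nX nTR : ℕ} (F : EucSp n → EucSp m → EucSp n) (D : Set (EucSp m))
    (g : Fin nX → EucSp n → ℝ → ℝ) (l : Fin nTR → EucSp n → ℝ) (T : ℝ)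
    (x : EucSp n) (t : ℝ) : ℝ :=
  sSup {r | ∃ d y, Admissible D t T d ∧ IsTraj F d t T x y ∧ r = payoff g l t T y}

/-- The standing regularity assumptions on the data of the differential game. -/
structure RegularData {n m nX nTR : ℕ} (F : EucSp n → EucSp m → EucSp n) (D : Set (EucSp m))
    (g : Fin nX → EucSp n → ℝ → ℝ) (l : Fin nTR → EucSp n → ℝ) (C L : ℝ) : Prop where
  nX_pos : 0 < nX
  nTR_pos : 0 < nTR
  nonempty : D.Nonempty
  cont : Continuous fun p : EucSp n × EucSp m => F p.1 p.2
  C_nonneg : 0 ≤ C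
  growth : ∀ x, ∀ d ∈ D, ‖F x d‖ ≤ C * (‖x‖ + 1)
  L_nonneg : 0 ≤ L
  lip : ∀ x y : EucSp n, ∀ d ∈ D, ‖F x d - F y d‖ ≤ L * ‖x - y‖
  lip_g : ∀ i, LocallyLipschitz fun p : EucSp n × ℝ => g i p.1 p.2
  lip_l : ∀ j, LocallyLipschitz (l j)

variable {n m nX nTR : ℕ} {F : EucSp n → EucSp m → EucSp n} {D : Set (EucSp m)}
  {g : Fin nX → EucSp n → ℝ → ℝ} {l : Fin nTR → EucSp n → ℝ} {C L : ℝ}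

lemma payoff_le_iff (hnX : 0 < nX) (hnTR : 0 < nTR)
    (hg : ∀ i, Continuous fun p : EucSp n × ℝ => g i p.1 p.2) {t T : ℝ} (htT : t ≤ T)
    {y : ℝ → EucSp n} (hy : ContinuousOn y (Icc t T)) {c : ℝ} :
    payoff g l t T y ≤ c ↔
      (∀ j, l j (y T) ≤ c) ∧ ∀ i, ∀ s ∈ Icc t T, g i (y s) s ≤ c := by
  have : Nonempty (Fin nX) := ⟨⟨0, hnX⟩⟩
  have : Nonempty (Fin nTR) := ⟨⟨0, hnTR⟩⟩
  have hbdd : ∀ i, BddAbove ((fun s => g i (y s) s) '' Icc t T) := fun i =>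
    (isCompact_Icc.image_of_continuousOn
      ((hg i).comp_continuousOn (hy.prodMk continuousOn_id))).bddAbove
  rw [payoff, max_le_iff, ciSup_le_iff (finite_range _).bddAbove,
    ciSup_le_iff (finite_range _).bddAbove]
  refine and_congr Iff.rfl (forall_congr' fun i => ?_)
  rw [csSup_le_iff (hbdd i) ((nonempty_Icc.2 htT).image _)]
  exact forall_mem_image

lemma exists_bound_and_lipschitz_on_ball
    (hg : ∀ i, LocallyLipschitz fun p : EucSp n × ℝ => g i p.1 p.2)
    (hl : ∀ j, LocallyLipschitz (l j)) (τ T ρ : ℝ) :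
    ∃ K, 0 ≤ K ∧
      (∀ i, ∀ x x' : EucSp n, ‖x‖ ≤ ρ → ‖x'‖ ≤ ρ → ∀ s ∈ Icc τ T, ∀ s' ∈ Icc τ T,
        g i x s ≤ g i x' s' + K * (‖x - x'‖ + |s - s'|)) ∧
      (∀ j, ∀ x x' : EucSp n, ‖x‖ ≤ ρ → ‖x'‖ ≤ ρ → l j x ≤ l j x' + K * ‖x - x'‖) ∧
      (∀ i, ∀ x : EucSp n, ‖x‖ ≤ ρ → ∀ s ∈ Icc τ T, g i x s ≤ K) ∧
      (∀ j, ∀ x : EucSp n, ‖x‖ ≤ ρ → l j x ≤ K) := by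
  have hcB : IsCompact (Metric.closedBall (0 : EucSp n) ρ) := isCompact_closedBall _ _
  have hcQ : IsCompact (Metric.closedBall (0 : EucSp n) ρ ×ˢ Icc τ T) := hcB.prod isCompact_Icc
  have h1 := fun i => ((hg i).locallyLipschitzOn (s :=
    Metric.closedBall (0 : EucSp n) ρ ×ˢ Icc τ T)).exists_lipschitzOnWith_of_compact hcQ
  have h2 := fun j => ((hl j).locallyLipschitzOn (s :=
    Metric.closedBall (0 : EucSp n) ρ)).exists_lipschitzOnWith_of_compact hcB
  have h3 := fun i => hcQ.exists_bound_of_continuousOn (hg i).continuous.continuousOn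
  have h4 := fun j => hcB.exists_bound_of_continuousOn (hl j).continuous.continuousOn
  choose K₁ hK₁ using h1
  choose K₂ hK₂ using h2
  choose K₃ hK₃ using h3
  choose K₄ hK₄ using h4
  obtain ⟨M₁, hM₁⟩ := (finite_range fun i => (K₁ i : ℝ)).bddAbove
  obtain ⟨M₂, hM₂⟩ := (finite_range fun j => (K₂ j : ℝ)).bddAbove
  obtain ⟨M₃, hM₃⟩ := (finite_range K₃).bddAbove
  obtain ⟨M₄, hM₄⟩ := (finite_range K₄).bddAbove
  set K := max 0 (max (max M₁ M₂) (max M₃ M₄)) with hK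
  have hKM₁ : M₁ ≤ K := by simp [hK]
  have hKM₂ : M₂ ≤ K := by simp [hK]
  have hKM₃ : M₃ ≤ K := by simp [hK]
  have hKM₄ : M₄ ≤ K := by simp [hK]
  refine ⟨K, le_max_left _ _, ?_, ?_, ?_, ?_⟩
  · intro i x x' hx hx' s hs s' hs'
    have h := (hK₁ i).dist_le_mul (x, s) ⟨by simpa using hx, hs⟩ (x', s') ⟨by simpa using hx', hs'⟩
    rw [Real.dist_eq] at h
    have hd : dist (x, s) (x', s') ≤ ‖x - x'‖ + |s - s'| := by
      rw [Prod.dist_eq, dist_eq_norm, Real.dist_eq]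
      exact max_le_add_of_nonneg (norm_nonneg _) (abs_nonneg _)
    have hle : (K₁ i : ℝ) ≤ K := (hM₁ ⟨i, rfl⟩).trans hKM₁
    have := (le_abs_self _).trans (h.trans (mul_le_mul hle hd dist_nonneg (le_max_left _ _)))
    linarith
  · intro j x x' hx hx'
    have h := (hK₂ j).dist_le_mul x (by simpa using hx) x' (by simpa using hx')
    rw [Real.dist_eq, dist_eq_norm] at h
    have hle : (K₂ j : ℝ) ≤ K := (hM₂ ⟨j, rfl⟩).trans hKM₂
    have := (le_abs_self _).trans (h.trans (mul_le_mul_of_nonneg_right hle (norm_nonneg _)))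
    linarith
  · intro i x hx s hs
    exact ((le_abs_self _).trans (hK₃ i (x, s) ⟨by simpa using hx, hs⟩)).trans
      ((hM₃ ⟨i, rfl⟩).trans hKM₃)
  · intro j x hx
    exact ((le_abs_self _).trans (hK₄ j x (by simpa using hx))).trans
      ((hM₄ ⟨j, rfl⟩).trans hKM₄)

namespace RegularData

/-- A radius containing every trajectory on a time interval of length at most `Δ` issued from
the ball of radius `ρ`. -/
def reachRadius (C Δ ρ : ℝ) : ℝ := 2 * (ρ + 1) * Real.exp ((2 * C + 1) * Δ)

lemma norm_traj_le (H : RegularData F D g l C L) {τ t T : ℝ} (ht : t ∈ Icc τ T)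
    {d : ℝ → EucSp m} (hd : Admissible D t T d) {x : EucSp n} {y : ℝ → EucSp n}
    (hy : IsTraj F d t T x y) {ρ : ℝ} (hx : ‖x‖ ≤ ρ) :
    ∀ s ∈ Icc t T, ‖y s‖ ≤ reachRadius C (T - τ) ρ := by
  intro s hs
  refine ((hy.integrable_and_norm_le H.cont H.C_nonneg H.growth ht.2 hd).2 s hs).trans ?_
  have h1 := H.C_nonneg
  have h2 : s - t ≤ T - τ := by linarith [hs.2, ht.1]
  have h3 : 0 ≤ ρ := (norm_nonneg x).trans hx
  unfold reachRadius
  gcongr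

lemma le_reachRadius (hC : 0 ≤ C) {Δ ρ : ℝ} (hΔ : 0 ≤ Δ) (hρ : 0 ≤ ρ) :
    ρ ≤ reachRadius C Δ ρ := by
  have : 1 ≤ Real.exp ((2 * C + 1) * Δ) := Real.one_le_exp (by positivity)
  unfold reachRadius
  nlinarith

lemma integrable_traj (H : RegularData F D g l C L) {t T : ℝ} (ht : t ≤ T)
    {d : ℝ → EucSp m} (hd : Admissible D t T d) {x : EucSp n} {y : ℝ → EucSp n}
    (hy : IsTraj F d t T x y) : IntervalIntegrable (fun r => F (y r) (d r)) volume t T :=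
  (hy.integrable_and_norm_le H.cont H.C_nonneg H.growth ht hd).1

lemma exists_traj (H : RegularData F D g l C L) {t T : ℝ} (ht : t ≤ T)
    {d : ℝ → EucSp m} (hd : Admissible D t T d) (x : EucSp n) : ∃ y, IsTraj F d t T x y :=
  exists_isTraj H.cont H.C_nonneg H.growth H.L_nonneg H.lip ht hd x

lemma valueFn_le_iff (H : RegularData F D g l C L) {t T : ℝ} (ht : t ≤ T) {x : EucSp n} {c : ℝ} :
    valueFn F D g l T x t ≤ c ↔ ∀ d y, Admissible D t T d → IsTraj F d t T x y →
      (∀ j, l j (y T) ≤ c) ∧ ∀ i, ∀ s ∈ Icc t T, g i (y s) s ≤ c := by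
  have hpay : ∀ d y, Admissible D t T d → IsTraj F d t T x y → ∀ c', (payoff g l t T y ≤ c' ↔
      (∀ j, l j (y T) ≤ c') ∧ ∀ i, ∀ s ∈ Icc t T, g i (y s) s ≤ c') := fun d y hd hy c' =>
    payoff_le_iff H.nX_pos H.nTR_pos (fun i => (H.lip_g i).continuous) ht
      (hy.continuousOn H.cont H.C_nonneg H.growth ht hd)
  obtain ⟨K, -, -, -, hKg, hKl⟩ := exists_bound_and_lipschitz_on_ball H.lip_g H.lip_l t T
    (reachRadius C (T - t) ‖x‖)
  have htt : t ∈ Icc t T := ⟨le_rfl, ht⟩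
  have hTT : T ∈ Icc t T := ⟨ht, le_rfl⟩
  have hbdd : BddAbove {r | ∃ d y, Admissible D t T d ∧ IsTraj F d t T x y ∧
      r = payoff g l t T y} := by
    refine ⟨K, ?_⟩
    rintro r ⟨d, y, hd, hy, rfl⟩
    have hb := H.norm_traj_le htt hd hy le_rfl
    exact (hpay d y hd hy K).2 ⟨fun j => hKl j _ (hb T hTT), fun i s hs => hKg i _ (hb s hs) s hs⟩
  obtain ⟨d₀, hd₀⟩ := H.nonempty
  obtain ⟨y₀, hy₀⟩ := H.exists_traj ht (admissible_const hd₀ t T) x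
  rw [valueFn, csSup_le_iff hbdd ⟨_, _, y₀, admissible_const hd₀ t T, hy₀, rfl⟩]
  constructor
  · intro h d y hd hy
    exact (hpay d y hd hy c).1 (h _ ⟨d, y, hd, hy, rfl⟩)
  · rintro h r ⟨d, y, hd, hy, rfl⟩
    exact (hpay d y hd hy c).2 (h d y hd hy)

lemma le_valueFn_of_traj (H : RegularData F D g l C L) {t T : ℝ} (ht : t ≤ T)
    {d : ℝ → EucSp m} (hd : Admissible D t T d) {x : EucSp n} {y : ℝ → EucSp n}
    (hy : IsTraj F d t T x y) :
    (∀ j, l j (y T) ≤ valueFn F D g l T x t) ∧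
      ∀ i, ∀ s ∈ Icc t T, g i (y s) s ≤ valueFn F D g l T x t :=
  (H.valueFn_le_iff ht).1 le_rfl d y hd hy

lemma constraint_le_valueFn (H : RegularData F D g l C L) {t T : ℝ} (ht : t ≤ T) (x : EucSp n)
    (i : Fin nX) : g i x t ≤ valueFn F D g l T x t := by
  obtain ⟨d₀, hd₀⟩ := H.nonempty
  obtain ⟨y, hy⟩ := H.exists_traj ht (admissible_const hd₀ t T) x
  have := (H.le_valueFn_of_traj ht (admissible_const hd₀ t T) hy).2 i t ⟨le_rfl, ht⟩
  rwa [hy.1] at this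

lemma target_le_valueFn (H : RegularData F D g l C L) (T : ℝ) (x : EucSp n)
    (j : Fin nTR) : l j x ≤ valueFn F D g l T x T := by
  obtain ⟨d₀, hd₀⟩ := H.nonempty
  obtain ⟨y, hy⟩ := H.exists_traj le_rfl (admissible_const hd₀ T T) x
  have := (H.le_valueFn_of_traj le_rfl (admissible_const hd₀ T T) hy).1 j
  rwa [hy.1] at this

/-- The value function is nonincreasing along trajectories. -/
lemma valueFn_traj_le (H : RegularData F D g l C L) {t t' T : ℝ} (htt' : t ≤ t') (ht'T : t' ≤ T)
    {d : ℝ → EucSp m} (hd : Admissible D t T d) {x : EucSp n} {y : ℝ → EucSp n}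
    (hy : IsTraj F d t T x y) :
    valueFn F D g l T (y t') t' ≤ valueFn F D g l T x t := by
  rw [H.valueFn_le_iff ht'T]
  intro d₂ y₂ hd₂ hy₂
  have htT := htt'.trans ht'T
  have hconcat := hy.concat htt' ht'T hy₂ (H.integrable_traj htT hd hy)
    (H.integrable_traj ht'T hd₂ hy₂)
  have h := H.le_valueFn_of_traj htT (hd.concat hd₂) hconcat
  have hval : ∀ s, t' ≤ s → (if s ≤ t' then y s else y₂ s) = y₂ s := by
    intro s hs
    split_ifs with h'
    · rw [le_antisymm h' hs, hy₂.1]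
    · rfl
  refine ⟨fun j => ?_, fun i s hs => ?_⟩
  · have := h.1 j
    rwa [hval T ht'T] at this
  · have := h.2 i s ⟨htt'.trans hs.1, hs.2⟩
    rwa [hval s hs.1] at this

lemma exists_valueFn_le_add_norm (H : RegularData F D g l C L) (τ T : ℝ) (ρ : ℝ) :
    ∃ K, 0 ≤ K ∧ ∀ t ∈ Icc τ T, ∀ x x' : EucSp n, ‖x‖ ≤ ρ → ‖x'‖ ≤ ρ →
      valueFn F D g l T x t ≤ valueFn F D g l T x' t + K * ‖x - x'‖ := by
  obtain ⟨K, hK0, hKg, hKl, -, -⟩ := exists_bound_and_lipschitz_on_ball H.lip_g H.lip_l τ T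
    (reachRadius C (T - τ) ρ)
  refine ⟨K * (2 * Real.exp ((2 * L + 1) * (T - τ))), by positivity, ?_⟩
  intro t ht x x' hx hx'
  rw [H.valueFn_le_iff ht.2]
  intro d y hd hy
  obtain ⟨y', hy'⟩ := H.exists_traj ht.2 hd x'
  have hb := H.norm_traj_le ht hd hy hx
  have hb' := H.norm_traj_le ht hd hy' hx'
  have hv := H.le_valueFn_of_traj ht.2 hd hy'
  have hdiff : ∀ s ∈ Icc t T,
      K * ‖y s - y' s‖ ≤ K * (2 * Real.exp ((2 * L + 1) * (T - τ))) * ‖x - x'‖ := by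
    intro s hs
    have h1 := hy.norm_sub_le H.L_nonneg H.lip ht.2 hd hy' (H.integrable_traj ht.2 hd hy)
      (H.integrable_traj ht.2 hd hy') s hs
    have h2 : Real.exp ((2 * L + 1) * (s - t)) ≤ Real.exp ((2 * L + 1) * (T - τ)) := by
      have := H.L_nonneg
      have h2 : s - t ≤ T - τ := by linarith [hs.2, ht.1]
      gcongr
    rw [mul_assoc]
    refine mul_le_mul_of_nonneg_left (h1.trans ?_) hK0
    nlinarith [norm_nonneg (x - x')]
  have hTT : T ∈ Icc t T := ⟨ht.2, le_rfl⟩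
  refine ⟨fun j => ?_, fun i s hs => ?_⟩
  · have := hKl j (y T) (y' T) (hb T hTT) (hb' T hTT)
    linarith [hv.1 j, hdiff T hTT]
  · have hsτ : s ∈ Icc τ T := ⟨ht.1.trans hs.1, hs.2⟩
    have := hKg i (y s) (y' s) (hb s hs) (hb' s hs) s hsτ s hsτ
    rw [sub_self, abs_zero, add_zero] at this
    linarith [hv.2 i s hs, hdiff s hs]

lemma norm_speed_le (H : RegularData F D g l C L) {τ t T : ℝ} (ht : t ∈ Icc τ T)
    {d : ℝ → EucSp m} (hd : Admissible D t T d) {x : EucSp n} {y : ℝ → EucSp n}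
    (hy : IsTraj F d t T x y) {ρ : ℝ} (hx : ‖x‖ ≤ ρ) :
    ∀ s ∈ Icc t T, ‖F (y s) (d s)‖ ≤ C * (reachRadius C (T - τ) ρ + 1) := by
  intro s hs
  refine (H.growth _ _ (hd.2 s hs)).trans ?_
  have := H.norm_traj_le ht hd hy hx s hs
  have := H.C_nonneg
  gcongr

/-- The value function is Lipschitz on bounded sets, jointly in space and time. -/
lemma exists_valueFn_lipschitz (H : RegularData F D g l C L) {τ T ρ : ℝ} (hτ : τ ≤ T)
    (hρ : 0 ≤ ρ) :
    ∃ K, 0 ≤ K ∧ ∀ t ∈ Icc τ T, ∀ t' ∈ Icc τ T, ∀ x x' : EucSp n, ‖x‖ ≤ ρ → ‖x'‖ ≤ ρ →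
      valueFn F D g l T x t ≤ valueFn F D g l T x' t' + K * (‖x - x'‖ + |t - t'|) := by
  set ρ' := reachRadius C (T - τ) ρ with hρ'
  have hρρ' : ρ ≤ ρ' := le_reachRadius H.C_nonneg (sub_nonneg.2 hτ) hρ
  obtain ⟨K₁, hK₁, hlip⟩ := H.exists_valueFn_le_add_norm τ T ρ'
  obtain ⟨K₂, hK₂, hKg, -, -, -⟩ := exists_bound_and_lipschitz_on_ball H.lip_g H.lip_l τ T ρ'
  set M := C * (ρ' + 1) with hM
  have hM0 : 0 ≤ M := mul_nonneg H.C_nonneg (by linarith)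
  set K := K₁ * (M + 1) + K₂ * (M + 1) with hK
  have hK0 : 0 ≤ K := by positivity
  have hKK₁ : K₁ ≤ K := by nlinarith [mul_nonneg hK₁ hM0, mul_nonneg hK₂ hM0]
  have hKM₁ : K₁ * M ≤ K := by nlinarith [mul_nonneg hK₂ hM0]
  have hKM₂ : K₂ * (M + 1) ≤ K := by nlinarith [mul_nonneg hK₁ hM0]
  have htime : ∀ t ∈ Icc τ T, ∀ t' ∈ Icc τ T, t ≤ t' → ∀ x : EucSp n, ‖x‖ ≤ ρ →
      valueFn F D g l T x t ≤ valueFn F D g l T x t' + K * (t' - t) ∧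
      valueFn F D g l T x t' ≤ valueFn F D g l T x t + K * (t' - t) := by
    intro t ht t' ht' htt' x hx
    have hdt : 0 ≤ t' - t := sub_nonneg.2 htt'
    have hKdt : K₁ * (M * (t' - t)) ≤ K * (t' - t) := by
      rw [← mul_assoc]; exact mul_le_mul_of_nonneg_right hKM₁ hdt
    constructor
    · rw [H.valueFn_le_iff ht.2]
      intro d y hd hy
      have hspeed := H.norm_speed_le ht hd hy hx
      have hb := H.norm_traj_le ht hd hy hx
      have hmove : ‖y t' - x‖ ≤ M * (t' - t) := hy.norm_sub_le_of_speed hspeed ⟨htt', ht'.2⟩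
      have hv := H.le_valueFn_of_traj ht'.2 (hd.mono htt')
        (hy.restrict (H.integrable_traj ht.2 hd hy) htt')
      have h1 := hlip t' ht' (y t') x (hb t' ⟨htt', ht'.2⟩) (hx.trans hρρ')
      have h2 : K₁ * ‖y t' - x‖ ≤ K₁ * (M * (t' - t)) := mul_le_mul_of_nonneg_left hmove hK₁
      refine ⟨fun j => ?_, fun i s hs => ?_⟩
      · linarith [hv.1 j]
      · rcases le_total t' s with hs' | hs'
        · linarith [hv.2 i s ⟨hs', hs.2⟩]
        · have h3 := hKg i (y s) x (hb s hs) (hx.trans hρρ') s ⟨ht.1.trans hs.1, hs.2⟩ t' ht'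
          have h4 := H.constraint_le_valueFn ht'.2 x i
          have h5 : ‖y s - x‖ ≤ M * (s - t) := hy.norm_sub_le_of_speed hspeed hs
          have h6 : |s - t'| ≤ t' - t := by
            rw [abs_le]; constructor <;> linarith [hs.1]
          have h7 : ‖y s - x‖ + |s - t'| ≤ (M + 1) * (t' - t) := by
            nlinarith [mul_le_mul_of_nonneg_left (sub_le_sub_right hs' t) hM0]
          have h8 := mul_le_mul_of_nonneg_left h7 hK₂
          have h9 := mul_le_mul_of_nonneg_right hKM₂ hdt
          linarith
    · obtain ⟨d₀, hd₀⟩ := H.nonempty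
      have hd := admissible_const hd₀ t T
      obtain ⟨y, hy⟩ := H.exists_traj ht.2 hd x
      have hspeed := H.norm_speed_le ht hd hy hx
      have hb := H.norm_traj_le ht hd hy hx
      have hmove : ‖y t' - x‖ ≤ M * (t' - t) := hy.norm_sub_le_of_speed hspeed ⟨htt', ht'.2⟩
      have h1 := hlip t' ht' x (y t') (hx.trans hρρ') (hb t' ⟨htt', ht'.2⟩)
      rw [norm_sub_rev] at h1
      have h2 : K₁ * ‖y t' - x‖ ≤ K₁ * (M * (t' - t)) := mul_le_mul_of_nonneg_left hmove hK₁
      have h3 := H.valueFn_traj_le htt' ht'.2 hd hy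
      linarith
  refine ⟨K, hK0, fun t ht t' ht' x x' hx hx' => ?_⟩
  have h1 := hlip t' ht' x x' (hx.trans hρρ') (hx'.trans hρρ')
  have h2 := mul_le_mul_of_nonneg_right hKK₁ (norm_nonneg (x - x'))
  rcases le_total t t' with h | h
  · have := (htime t ht t' ht' h x hx).1
    rw [abs_of_nonpos (sub_nonpos.2 h)]
    linarith
  · have := (htime t' ht' t ht h x hx).2
    rw [abs_of_nonneg (sub_nonneg.2 h)]
    linarith

/-- Infinitesimal form of the monotonicity of the value function along trajectories. -/
lemma exists_valueFn_step_le (H : RegularData F D g l C L) {τ T ρ : ℝ} (hτ : τ ≤ T)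
    (hρ : 0 ≤ ρ) :
    ∃ K, 0 ≤ K ∧ ∀ t ∈ Icc τ T, ∀ h, 0 ≤ h → t + h ≤ T → ∀ d ∈ D, ∀ x v : EucSp n,
      ‖x‖ ≤ ρ → ‖x + h • v‖ ≤ ρ →
      valueFn F D g l T (x + h • v) (t + h) ≤
        valueFn F D g l T x t + h * (K * ‖v - F x d‖ + K * h) := by
  set ρ' := reachRadius C (T - τ) ρ with hρ'
  have hρρ' : ρ ≤ ρ' := le_reachRadius H.C_nonneg (sub_nonneg.2 hτ) hρ
  obtain ⟨K₁, hK₁, hlip⟩ := H.exists_valueFn_le_add_norm τ T ρ'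
  set M := C * (ρ' + 1) with hM
  have hM0 : 0 ≤ M := mul_nonneg H.C_nonneg (by linarith)
  have hL := H.L_nonneg
  refine ⟨K₁ * (L * M + 1), by positivity, fun t ht h hh hhT d hd x v hx hxv => ?_⟩
  have hadm := admissible_const hd t T
  obtain ⟨y, hy⟩ := H.exists_traj ht.2 hadm x
  have hth : t + h ∈ Icc t T := ⟨by linarith, hhT⟩
  have h1 := H.valueFn_traj_le hth.1 hhT hadm hy
  have h2 := hlip (t + h) ⟨ht.1.trans hth.1, hhT⟩ (x + h • v) (y (t + h)) (hxv.trans hρρ')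
    (H.norm_traj_le ht hadm hy hx _ hth)
  have h3 : ‖y (t + h) - x - h • F x d‖ ≤ L * M * h * h :=
    hy.norm_sub_sub_smul_le hL H.lip hd (H.integrable_traj ht.2 hadm hy)
      (H.norm_speed_le ht hadm hy hx) hh hhT
  have h4 : ‖x + h • v - y (t + h)‖ ≤ h * ‖v - F x d‖ + L * M * h * h := by
    have heq : x + h • v - y (t + h) = h • (v - F x d) - (y (t + h) - x - h • F x d) := by
      rw [smul_sub]; abel
    rw [heq]
    refine (norm_sub_le _ _).trans (add_le_add (le_of_eq ?_) h3)
    rw [norm_smul, Real.norm_of_nonneg hh]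
  have h5 := mul_le_mul_of_nonneg_left h4 hK₁
  have hLM : 0 ≤ L * M := mul_nonneg hL hM0
  have h6 : 0 ≤ K₁ * (L * M) * (h * ‖v - F x d‖) := by positivity
  have h7 : 0 ≤ K₁ * (h * h) := by positivity
  nlinarith

end RegularData

end ValueFunction

section Polynomials

variable {n : ℕ}

namespace IsPolyFun

lemma const (c : ℝ) : IsPolyFun fun (_ : EucSp n) (_ : ℝ) => c :=
  ⟨MvPolynomial.C c, by simp⟩

lemma coord (i : Fin n) : IsPolyFun fun (x : EucSp n) (_ : ℝ) => x i :=
  ⟨MvPolynomial.X (Sum.inl i), by simp⟩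

lemma time : IsPolyFun fun (_ : EucSp n) (t : ℝ) => t :=
  ⟨MvPolynomial.X (Sum.inr ()), by simp⟩

lemma add {φ ψ : EucSp n → ℝ → ℝ} (hφ : IsPolyFun φ) (hψ : IsPolyFun ψ) :
    IsPolyFun fun x t => φ x t + ψ x t := by
  obtain ⟨p, hp⟩ := hφ
  obtain ⟨q, hq⟩ := hψ
  exact ⟨p + q, fun x t => by simp only [map_add, hp, hq]⟩

lemma mul {φ ψ : EucSp n → ℝ → ℝ} (hφ : IsPolyFun φ) (hψ : IsPolyFun ψ) :
    IsPolyFun fun x t => φ x t * ψ x t := by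
  obtain ⟨p, hp⟩ := hφ
  obtain ⟨q, hq⟩ := hψ
  exact ⟨p * q, fun x t => by simp only [map_mul, hp, hq]⟩

lemma sum {ι : Type*} (s : Finset ι) {φ : ι → EucSp n → ℝ → ℝ} (h : ∀ i, IsPolyFun (φ i)) :
    IsPolyFun fun x t => ∑ i ∈ s, φ i x t := by
  choose p hp using h
  exact ⟨∑ i ∈ s, p i, fun x t => by rw [map_sum]; exact Finset.sum_congr rfl fun i _ => hp i x t⟩

lemma differentiable {ψ : EucSp n → ℝ → ℝ} (h : IsPolyFun ψ) :
    Differentiable ℝ fun p : EucSp n × ℝ => ψ p.1 p.2 := by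
  obtain ⟨p, hp⟩ := h
  simp_rw [hp]
  clear hp
  induction p using MvPolynomial.induction_on with
  | C a => simp
  | add p q hp hq =>
    simp only [map_add]
    exact hp.add hq
  | mul_X p i hp =>
    simp only [map_mul, MvPolynomial.eval_X]
    refine hp.mul ?_
    rcases i with i | i
    · simp only [Sum.elim_inl]; fun_prop
    · simp only [Sum.elim_inr]; fun_prop

/-- The total derivative of a polynomial along the direction `(v, 1)`. -/
lemma hasDerivAt_line {ψ : EucSp n → ℝ → ℝ} (h : IsPolyFun ψ) (x v : EucSp n) (t : ℝ) :
    HasDerivAt (fun s : ℝ => ψ (x + s • v) (t + s))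
      (deriv (ψ x) t + ⟪gradient (fun z => ψ z t) x, v⟫) 0 := by
  have hd : HasFDerivAt (fun p : EucSp n × ℝ => ψ p.1 p.2)
      (fderiv ℝ (fun p : EucSp n × ℝ => ψ p.1 p.2) (x, t)) (x, t) :=
    (h.differentiable (x, t)).hasFDerivAt
  set ψ' := fderiv ℝ (fun p : EucSp n × ℝ => ψ p.1 p.2) (x, t)
  have htime : deriv (ψ x) t = ψ' (0, 1) := by
    have h1 : HasDerivAt (fun s : ℝ => ((x, s) : EucSp n × ℝ)) (0, 1) t :=
      (hasDerivAt_const t x).prodMk (hasDerivAt_id t)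
    exact (hd.comp_hasDerivAt t h1).deriv
  have hspace : ⟪gradient (fun z => ψ z t) x, v⟫ = ψ' (v, 0) := by
    have h0 : HasFDerivAt (fun z : EucSp n => ((z, t) : EucSp n × ℝ))
        (.prod (.id ℝ (EucSp n)) (0 : EucSp n →L[ℝ] ℝ)) x :=
      (hasFDerivAt_id x).prodMk (hasFDerivAt_const t x)
    have h1 : HasFDerivAt (fun z => ψ z t) (ψ'.comp (.prod (.id ℝ _) 0)) x :=
      HasFDerivAt.comp (f := fun z : EucSp n => ((z, t) : EucSp n × ℝ)) x hd h0
    rw [gradient, InnerProductSpace.toDual_symm_apply, h1.fderiv]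
    simp
  have hline : HasDerivAt (fun s : ℝ => ((x + s • v, t + s) : EucSp n × ℝ)) (v, 1) 0 := by
    have h1 : HasDerivAt (fun s : ℝ => x + s • v) v 0 := by
      simpa using ((hasDerivAt_id (0 : ℝ)).smul_const v).const_add x
    exact h1.prodMk ((hasDerivAt_id (0 : ℝ)).const_add t)
  have hcomp := HasFDerivAt.comp_hasDerivAt (l := fun p : EucSp n × ℝ => ψ p.1 p.2) (l' := ψ')
    (0 : ℝ) (by simpa using hd) hline
  refine hcomp.congr_deriv ?_
  rw [htime, hspace, ← map_add]
  simp

end IsPolyFun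

/-- A polynomial kernel peaked at the origin. -/
def peakKernel (a : ℝ) (q : EucSp n × ℝ) : ℝ := 1 - a * (‖q.1‖ ^ 2 + q.2 ^ 2)

lemma continuous_peakKernel (a : ℝ) : Continuous (peakKernel (n := n) a) := by
  unfold peakKernel; fun_prop

lemma peakKernel_sub (a : ℝ) (x : EucSp n) (t : ℝ) (q : EucSp n × ℝ) :
    peakKernel a ((x, t) - q) = (1 - a * (‖x‖ ^ 2 + t ^ 2)) + ∑ i, 2 * a * x i * q.1 i
      + 2 * a * t * q.2 + -a * (‖q.1‖ ^ 2 + q.2 ^ 2) := by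
  have h : ⟪x, q.1⟫ = ∑ i, x i * q.1 i := by
    simp [PiLp.inner_apply, mul_comm]
  have h2 : ∑ i, 2 * a * x i * q.1 i = 2 * a * ⟪x, q.1⟫ := by
    rw [h, Finset.mul_sum]; exact Finset.sum_congr rfl fun i _ => by ring
  rw [h2, peakKernel]
  simp only [Prod.fst_sub, Prod.snd_sub]
  rw [norm_sub_sq_real]
  ring

/-- Convolving a compactly supported function with a power of the kernel gives a polynomial. -/
lemma isPolyFun_integral_peakKernel (μ : Measure (EucSp n × ℝ)) [IsFiniteMeasureOnCompacts μ]
    (a : ℝ) (k : ℕ) (w : EucSp n × ℝ → ℝ) (hw : Continuous w) (hws : HasCompactSupport w) :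
    IsPolyFun fun x t => ∫ q, w q * peakKernel a ((x, t) - q) ^ k ∂μ := by
  induction k generalizing w with
  | zero => simpa using IsPolyFun.const (n := n) (∫ q, w q ∂μ)
  | succ k ih =>
    have hint : ∀ b : EucSp n × ℝ → ℝ, Continuous b → ∀ x t,
        Integrable (fun q => (w q * b q) * peakKernel a ((x, t) - q) ^ k) μ := by
      intro b hb x t
      apply Continuous.integrable_of_hasCompactSupport
      · have := continuous_peakKernel (n := n) a
        fun_prop
      · exact (hws.mul_right).mul_right
    have hpoly : ∀ b : EucSp n × ℝ → ℝ, Continuous b →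
        IsPolyFun fun x t => ∫ q, (w q * b q) * peakKernel a ((x, t) - q) ^ k ∂μ :=
      fun b hb => ih _ (hw.mul hb) hws.mul_right
    have hb₀ : Continuous fun _ : EucSp n × ℝ => (1 : ℝ) := continuous_const
    have hb₁ : ∀ i, Continuous fun q : EucSp n × ℝ => q.1 i := fun i => by fun_prop
    have hb₂ : Continuous fun q : EucSp n × ℝ => q.2 := continuous_snd
    have hb₃ : Continuous fun q : EucSp n × ℝ => -a * (‖q.1‖ ^ 2 + q.2 ^ 2) := by fun_prop
    have heq : (fun x t => ∫ q, w q * peakKernel a ((x, t) - q) ^ (k + 1) ∂μ) = fun x t =>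
        (1 + -a * ((∑ i, x i * x i) + t * t)) *
            (∫ q, (w q * 1) * peakKernel a ((x, t) - q) ^ k ∂μ)
          + ∑ i, (2 * a) * x i * (∫ q, (w q * q.1 i) * peakKernel a ((x, t) - q) ^ k ∂μ)
          + (2 * a) * t * (∫ q, (w q * q.2) * peakKernel a ((x, t) - q) ^ k ∂μ)
          + ∫ q, (w q * (-a * (‖q.1‖ ^ 2 + q.2 ^ 2))) * peakKernel a ((x, t) - q) ^ k ∂μ := by
      funext x t
      have hsq : ∑ i, x i * x i = ‖x‖ ^ 2 := by
        rw [EuclideanSpace.real_norm_sq_eq]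
        exact Finset.sum_congr rfl fun i _ => by ring
      simp only [← integral_const_mul]
      rw [← integral_finsetSum _ fun i _ => (hint _ (hb₁ i) x t).const_mul _,
        ← integral_add, ← integral_add, ← integral_add]
      · refine integral_congr_ae (ae_of_all _ fun q => ?_)
        simp only
        rw [pow_succ, peakKernel_sub, hsq]
        have : ∑ i, 2 * a * x i * (w q * q.1 i * peakKernel a ((x, t) - q) ^ k) =
            (∑ i, 2 * a * x i * q.1 i) * (w q * peakKernel a ((x, t) - q) ^ k) := by
          rw [Finset.sum_mul]; exact Finset.sum_congr rfl fun i _ => by ring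
        rw [← peakKernel_sub, this, peakKernel_sub]
        ring
      all_goals
        repeat' first
          | exact (hint _ hb₀ x t).const_mul _
          | exact (hint _ hb₂ x t).const_mul _
          | exact hint _ hb₃ x t
          | exact integrable_finsetSum _ fun i _ => (hint _ (hb₁ i) x t).const_mul _
          | apply Integrable.add
    rw [heq]
    refine IsPolyFun.add (IsPolyFun.add (IsPolyFun.add (IsPolyFun.mul ?_ (hpoly _ hb₀)) ?_) ?_)
      (hpoly _ hb₃)
    · exact (IsPolyFun.const 1).add ((IsPolyFun.const (-a)).mul
        ((IsPolyFun.sum _ fun i => (IsPolyFun.coord i).mul (IsPolyFun.coord i)).add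
          (IsPolyFun.time.mul IsPolyFun.time)))
    · exact IsPolyFun.sum _ fun i =>
        ((IsPolyFun.const (2 * a)).mul (IsPolyFun.coord i)).mul (hpoly _ (hb₁ i))
    · exact ((IsPolyFun.const (2 * a)).mul IsPolyFun.time).mul (hpoly _ hb₂)

end Polynomials

section Smoothing

variable {n : ℕ}

/-- Average of `φ` over the closed ball of radius `ρ` against the normalized `k`-th power of the
peak kernel. -/
def peakAverage (ρ : ℝ) (k : ℕ) (φ : EucSp n × ℝ → ℝ) : ℝ :=
  (∫ q in Metric.closedBall (0 : EucSp n × ℝ) ρ, peakKernel (1 / (4 * ρ ^ 2)) q ^ k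
      ∂(volume.prod volume))⁻¹ •
    ∫ q in Metric.closedBall (0 : EucSp n × ℝ) ρ, peakKernel (1 / (4 * ρ ^ 2)) q ^ k • φ q
      ∂(volume.prod volume)

lemma half_le_peakKernel {ρ : ℝ} (hρ : 0 < ρ) {q : EucSp n × ℝ}
    (hq : q ∈ Metric.closedBall (0 : EucSp n × ℝ) ρ) : 1 / 2 ≤ peakKernel (1 / (4 * ρ ^ 2)) q := by
  rw [mem_closedBall_zero_iff, Prod.norm_def, max_le_iff] at hq
  have h1 : ‖q.1‖ ^ 2 ≤ ρ ^ 2 := pow_le_pow_left₀ (norm_nonneg _) hq.1 2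
  have h2 : q.2 ^ 2 ≤ ρ ^ 2 := by
    rw [← sq_abs]; exact pow_le_pow_left₀ (abs_nonneg _) hq.2 2
  have h3 : 1 / (4 * ρ ^ 2) * (‖q.1‖ ^ 2 + q.2 ^ 2) ≤ 1 / (4 * ρ ^ 2) * (2 * ρ ^ 2) := by
    gcongr; linarith
  have h4 : 1 / (4 * ρ ^ 2) * (2 * ρ ^ 2) = 1 / 2 := by field_simp; norm_num
  unfold peakKernel
  linarith

lemma integrableOn_peakKernel_pow_smul (ρ a : ℝ) (k : ℕ) {φ : EucSp n × ℝ → ℝ}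
    (hφ : Continuous φ) :
    IntegrableOn (fun q => peakKernel a q ^ k • φ q) (Metric.closedBall (0 : EucSp n × ℝ) ρ)
      (volume.prod volume) :=
  ((((continuous_peakKernel a).pow k).smul hφ).continuousOn).integrableOn_compact
    (isCompact_closedBall _ _)

lemma peakKernel_pow_integral_pos {ρ : ℝ} (hρ : 0 < ρ) (k : ℕ) :
    0 < ∫ q in Metric.closedBall (0 : EucSp n × ℝ) ρ, peakKernel (1 / (4 * ρ ^ 2)) q ^ k
      ∂(volume.prod volume) := by
  have hint := integrableOn_peakKernel_pow_smul (n := n) ρ (1 / (4 * ρ ^ 2)) k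
    (φ := fun _ => 1) continuous_const
  simp only [smul_eq_mul, mul_one] at hint
  have hle := setIntegral_ge_of_const_le_real (c := (1 / 2 : ℝ) ^ k)
    Metric.isClosed_closedBall.measurableSet (isCompact_closedBall _ _).measure_lt_top.ne
    (fun q hq => pow_le_pow_left₀ (by norm_num) (half_le_peakKernel hρ hq) k) hint
  refine lt_of_lt_of_le (mul_pos (by positivity) ?_) hle
  exact ENNReal.toReal_pos (Metric.measure_closedBall_pos _ _ hρ).ne'
    (isCompact_closedBall _ _).measure_lt_top.ne

lemma peakAverage_mono {ρ : ℝ} (hρ : 0 < ρ) (k : ℕ) {φ₁ φ₂ : EucSp n × ℝ → ℝ}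
    (h₁ : Continuous φ₁) (h₂ : Continuous φ₂) (h : ∀ q, φ₁ q ≤ φ₂ q) :
    peakAverage ρ k φ₁ ≤ peakAverage ρ k φ₂ := by
  refine mul_le_mul_of_nonneg_left ?_ (inv_nonneg.2 (peakKernel_pow_integral_pos hρ k).le)
  refine setIntegral_mono_on (integrableOn_peakKernel_pow_smul _ _ _ h₁)
    (integrableOn_peakKernel_pow_smul _ _ _ h₂) Metric.isClosed_closedBall.measurableSet
    fun q hq => ?_
  have := half_le_peakKernel hρ hq
  exact mul_le_mul_of_nonneg_left (h q) (pow_nonneg (by linarith) k)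

lemma peakAverage_affine {ρ : ℝ} (hρ : 0 < ρ) (k : ℕ) {φ₁ φ₂ : EucSp n × ℝ → ℝ}
    (h₁ : Continuous φ₁) (h₂ : Continuous φ₂) (α β : ℝ) :
    peakAverage ρ k (fun q => φ₁ q + α * φ₂ q + β) =
      peakAverage ρ k φ₁ + α * peakAverage ρ k φ₂ + β := by
  have hpos := peakKernel_pow_integral_pos (n := n) hρ k
  have hi₁ := integrableOn_peakKernel_pow_smul ρ (1 / (4 * ρ ^ 2)) k h₁
  have hi₂ := integrableOn_peakKernel_pow_smul ρ (1 / (4 * ρ ^ 2)) k h₂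
  have hi₃ := integrableOn_peakKernel_pow_smul (n := n) ρ (1 / (4 * ρ ^ 2)) k
    (φ := fun _ => 1) continuous_const
  simp only [smul_eq_mul] at hi₁ hi₂ hi₃
  have heq : ∀ q, peakKernel (1 / (4 * ρ ^ 2)) q ^ k * (φ₁ q + α * φ₂ q + β) =
      peakKernel (1 / (4 * ρ ^ 2)) q ^ k * φ₁ q + α * (peakKernel (1 / (4 * ρ ^ 2)) q ^ k * φ₂ q)
        + β * (peakKernel (1 / (4 * ρ ^ 2)) q ^ k * 1) := fun q => by ring
  have hi₁₂ : IntegrableOn (fun q => peakKernel (1 / (4 * ρ ^ 2)) q ^ k * φ₁ q +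
      α * (peakKernel (1 / (4 * ρ ^ 2)) q ^ k * φ₂ q)) (Metric.closedBall (0 : EucSp n × ℝ) ρ)
      (volume.prod volume) := hi₁.add (hi₂.const_mul α)
  simp only [peakAverage, smul_eq_mul, heq]
  rw [integral_add hi₁₂ (hi₃.const_mul β),
    integral_add hi₁ (hi₂.const_mul α), integral_const_mul, integral_const_mul]
  simp only [mul_one]
  field_simp

lemma tendsto_peakAverage_norm {ρ : ℝ} (hρ : 0 < ρ) :
    Tendsto (fun k => peakAverage (n := n) ρ k fun q => ‖q‖) atTop (𝓝 0) := by
  have hbase : peakKernel (n := n) (1 / (4 * ρ ^ 2)) 0 = 1 := by simp [peakKernel]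
  have h := tendsto_setIntegral_pow_smul_of_unique_maximum_of_isCompact_of_continuousOn
    (μ := (volume : Measure (EucSp n)).prod (volume : Measure ℝ)) (x₀ := 0)
    (s := Metric.closedBall (0 : EucSp n × ℝ) ρ) (isCompact_closedBall _ _)
    (c := peakKernel (1 / (4 * ρ ^ 2))) (g := fun q => ‖q‖)
    (continuous_peakKernel _).continuousOn ?_ ?_ ?_ ?_ continuous_norm.continuousOn
  · simpa [peakAverage] using h
  · intro q _ hq0
    rw [hbase]
    have hsum : 0 < ‖q.1‖ ^ 2 + q.2 ^ 2 := by
      by_contra hcon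
      have h1 : ‖q.1‖ ^ 2 = 0 := by nlinarith [sq_nonneg ‖q.1‖, sq_nonneg q.2]
      have h2 : q.2 ^ 2 = 0 := by nlinarith [sq_nonneg ‖q.1‖, sq_nonneg q.2]
      exact hq0 (Prod.ext (by simpa using h1) (by simpa using h2))
    have : 0 < 1 / (4 * ρ ^ 2) * (‖q.1‖ ^ 2 + q.2 ^ 2) := by positivity
    unfold peakKernel
    linarith
  · intro q hq
    linarith [half_le_peakKernel hρ hq]
  · rw [hbase]; exact one_pos
  · apply subset_closure
    rw [mem_interior_iff_mem_nhds]
    exact Metric.closedBall_mem_nhds _ hρ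

/-- For a compactly supported function, averaging its translates is a polynomial operation. -/
lemma exists_isPolyFun_eq_peakAverage {w : EucSp n × ℝ → ℝ} (hw : Continuous w) {ρ' r : ℝ}
    (hsupp : ∀ q, ρ' < ‖q‖ → w q = 0) (k : ℕ) :
    ∃ ψ, IsPolyFun ψ ∧ ∀ p : EucSp n × ℝ, ‖p‖ ≤ r →
      ψ p.1 p.2 = peakAverage (r + ρ') k fun q => w (p - q) := by
  set ρ := r + ρ' with hρ
  set a := 1 / (4 * ρ ^ 2) with ha
  set I := ∫ q in Metric.closedBall (0 : EucSp n × ℝ) ρ, peakKernel a q ^ k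
      ∂(volume.prod volume)
  have hws : HasCompactSupport w := by
    refine HasCompactSupport.intro (isCompact_closedBall (0 : EucSp n × ℝ) ρ') fun q hq => ?_
    exact hsupp q (by simpa using hq)
  refine ⟨_, (IsPolyFun.const I⁻¹).mul (isPolyFun_integral_peakKernel
    ((volume : Measure (EucSp n)).prod (volume : Measure ℝ)) a k w hw hws), fun p hp => ?_⟩
  rw [peakAverage, smul_eq_mul]
  congr 1
  have : ((volume : Measure (EucSp n)).prod (volume : Measure ℝ)).IsNegInvariant :=
    Measure.IsAddHaarMeasure.isNegInvariant_of_regular _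
  have h1 := integral_sub_left_eq_self (fun q => w q * peakKernel a (p - q) ^ k)
    ((volume : Measure (EucSp n)).prod (volume : Measure ℝ)) p
  simp only [sub_sub_cancel] at h1
  change ∫ q, w q * peakKernel a (p - q) ^ k ∂_ = _
  rw [← h1, setIntegral_eq_integral_of_forall_compl_eq_zero]
  · exact integral_congr_ae (ae_of_all _ fun q => by simp only [smul_eq_mul]; ring)
  · intro q hq
    rw [mem_closedBall_zero_iff, not_le] at hq
    rw [hsupp (p - q), smul_zero]
    have := norm_sub_norm_le q p
    rw [norm_sub_rev] at this
    linarith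

/-- One-sided polynomial smoothing of a compactly supported Lipschitz function: the polynomial is
uniformly close to the function, and inherits one-sided bounds on difference quotients. -/
lemma exists_isPolyFun_smoothing {w : EucSp n × ℝ → ℝ} {K : NNReal} (hw : LipschitzWith K w)
    {ρ' r : ℝ} (hρ' : 0 < ρ') (hr : 0 ≤ r) (hsupp : ∀ q, ρ' < ‖q‖ → w q = 0)
    {η : ℝ} (hη : 0 < η) :
    ∃ ψ : EucSp n → ℝ → ℝ, IsPolyFun ψ ∧
      (∀ p : EucSp n × ℝ, ‖p‖ ≤ r → |ψ p.1 p.2 - w p| ≤ K * η) ∧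
      ∀ (p : EucSp n × ℝ) (v : EucSp n) (C h₀ : ℝ), ‖p‖ ≤ r → 0 < h₀ → 0 ≤ C →
        (∀ (q : EucSp n × ℝ) (h : ℝ), 0 < h → h < h₀ →
          w (p + h • (v, 1) - q) ≤ w (p - q) + h * (C * ‖q‖ + C * h)) →
        deriv (ψ p.1) p.2 + ⟪gradient (fun z => ψ z p.2) p.1, v⟫ ≤ C * η := by
  have hρ : 0 < r + 1 + ρ' := by positivity
  obtain ⟨k, hk⟩ := ((tendsto_peakAverage_norm (n := n) hρ).eventually (gt_mem_nhds hη)).exists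
  obtain ⟨ψ, hψ, hψeq⟩ := exists_isPolyFun_eq_peakAverage (r := r + 1) hw.continuous hsupp k
  have hwc := hw.continuous
  have htrans : ∀ p, Continuous fun q => w (p - q) := fun p => by fun_prop
  refine ⟨ψ, hψ, fun p hp => ?_, fun p v C h₀ hp hh₀ hC hstep => ?_⟩
  · rw [hψeq p (by linarith)]
    have hlip : ∀ q, |w (p - q) - w p| ≤ K * ‖q‖ := fun q => by
      have := hw.dist_le_mul (p - q) p
      rwa [Real.dist_eq, dist_eq_norm, sub_sub_cancel_left, norm_neg] at this
    have hconst : ∀ α β : ℝ, peakAverage (r + 1 + ρ') k (fun q : EucSp n × ℝ => α * ‖q‖ + β) =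
        α * peakAverage (n := n) (r + 1 + ρ') k (fun q => ‖q‖) + β := fun α β => by
      have := peakAverage_affine (n := n) hρ k (φ₁ := fun _ => 0) (φ₂ := fun q => ‖q‖)
        continuous_const continuous_norm α β
      simpa [peakAverage] using this
    have hup := peakAverage_mono hρ k (htrans p)
      (φ₂ := fun q => (K : ℝ) * ‖q‖ + w p) (by fun_prop)
      fun q => by linarith [(abs_le.1 (hlip q)).2]
    have hlow := peakAverage_mono hρ k (φ₁ := fun q => -(K : ℝ) * ‖q‖ + w p) (by fun_prop)
      (htrans p) fun q => by linarith [(abs_le.1 (hlip q)).1]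
    rw [hconst] at hup hlow
    have hK := mul_le_mul_of_nonneg_left hk.le K.coe_nonneg
    rw [abs_le]
    constructor <;> linarith
  · have hder := (hψ.hasDerivAt_line p.1 v p.2).tendsto_slope_zero_right
    set A := peakAverage (n := n) (r + 1 + ρ') k fun q => ‖q‖
    have hlim : Tendsto (fun h : ℝ => C * A + C * h) (𝓝[>] 0) (𝓝 (C * A + C * 0)) :=
      (Continuous.tendsto (by fun_prop) 0).mono_left nhdsWithin_le_nhds
    have hle : deriv (ψ p.1) p.2 + ⟪gradient (fun z => ψ z p.2) p.1, v⟫ ≤ C * A + C * 0 := by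
      refine le_of_tendsto_of_tendsto hder hlim ?_
      have hsmall : ∀ᶠ h : ℝ in 𝓝[>] 0, ‖p + h • (v, (1 : ℝ))‖ < r + 1 := by
        have hc : Tendsto (fun h : ℝ => ‖p + h • (v, (1 : ℝ))‖) (𝓝 0) (𝓝 ‖p‖) :=
          Continuous.tendsto' (by fun_prop) _ _ (by simp)
        exact (hc.eventually (gt_mem_nhds (by linarith))).filter_mono nhdsWithin_le_nhds
      filter_upwards [hsmall, Ioo_mem_nhdsGT hh₀] with h hnorm hh
      have heq : ψ (p.1 + (0 + h) • v) (p.2 + (0 + h)) =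
          peakAverage (r + 1 + ρ') k fun q => w (p + h • (v, 1) - q) := by
        rw [← hψeq _ hnorm.le]
        simp
      have heq0 : ψ (p.1 + (0 : ℝ) • v) (p.2 + 0) =
          peakAverage (r + 1 + ρ') k fun q => w (p - q) := by
        rw [← hψeq p (by linarith)]
        simp
      have hmono := peakAverage_mono hρ k (htrans (p + h • (v, 1)))
        (φ₂ := fun q => w (p - q) + h * C * ‖q‖ + h * C * h) (by fun_prop)
        fun q => (hstep q h hh.1 hh.2).trans (le_of_eq (by ring))
      rw [peakAverage_affine hρ k (htrans p) continuous_norm] at hmono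
      rw [heq, heq0, smul_eq_mul, inv_mul_le_iff₀ hh.1]
      linarith
    have := mul_le_mul_of_nonneg_left hk.le hC
    linarith

end Smoothing

section Approximation

/-- A Lipschitz function on a bounded set extends to a boundedly supported Lipschitz function. -/
lemma LipschitzOnWith.exists_extension_bounded_support {E : Type*} [SeminormedAddCommGroup E]
    {W : E → ℝ} {A : Set E} {K : NNReal} (hW : LipschitzOnWith K W A) {ρ : ℝ}
    (hA : A ⊆ Metric.closedBall 0 ρ) :
    ∃ (K' : NNReal) (w : E → ℝ), LipschitzWith K' w ∧ EqOn w W A ∧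
      ∀ q, ρ + 1 < ‖q‖ → w q = 0 := by
  classical
  obtain ⟨M, hM0, hM⟩ : ∃ M : ℝ, 0 ≤ M ∧ ∀ p ∈ A, |W p| ≤ M := by
    rcases A.eq_empty_or_nonempty with rfl | ⟨p₀, hp₀⟩
    · exact ⟨0, le_rfl, by simp⟩
    refine ⟨|W p₀| + K * (2 * |ρ|), by positivity, fun p hp => ?_⟩
    have hd := hW.dist_le_mul p hp p₀ hp₀
    have hdist : dist p p₀ ≤ 2 * |ρ| := by
      have h1 := dist_triangle_right p p₀ 0
      have h2 := Metric.mem_closedBall.1 (hA hp)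
      have h3 := Metric.mem_closedBall.1 (hA hp₀)
      linarith [le_abs_self ρ]
    have hK := mul_le_mul_of_nonneg_left hdist K.coe_nonneg
    rw [Real.dist_eq] at hd
    linarith [abs_sub_abs_le_abs_sub (W p) (W p₀)]
  have hnorm : ∀ p ∈ A, ‖p‖ ≤ ρ := fun p hp => by simpa using hA hp
  have hout : ∀ q, ρ + 1 < ‖q‖ → q ∉ A := fun q hq hqA => by linarith [hnorm q hqA]
  have hcross : ∀ p ∈ A, ∀ q, ρ + 1 < ‖q‖ → |W p| ≤ (K + M) * ‖p - q‖ := by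
    intro p hp q hq
    have h1 : 1 ≤ ‖p - q‖ := by
      have := norm_sub_norm_le q p
      rw [norm_sub_rev] at this
      linarith [hnorm p hp]
    nlinarith [hM p hp, K.coe_nonneg]
  have hlip : LipschitzOnWith (K + M.toNNReal) (A.indicator W) (A ∪ {q | ρ + 1 < ‖q‖}) := by
    refine LipschitzOnWith.of_dist_le_mul fun p hp q hq => ?_
    rw [NNReal.coe_add, Real.coe_toNNReal _ hM0, Real.dist_eq, dist_eq_norm]
    rcases hp with hp | hp <;> rcases hq with hq | hq
    · rw [indicator_of_mem hp, indicator_of_mem hq]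
      have := hW.dist_le_mul p hp q hq
      rw [Real.dist_eq, dist_eq_norm] at this
      nlinarith [norm_nonneg (p - q)]
    · rw [indicator_of_mem hp, indicator_of_notMem (hout q hq), sub_zero]
      exact hcross p hp q hq
    · rw [indicator_of_mem hq, indicator_of_notMem (hout p hp), zero_sub, abs_neg, norm_sub_rev]
      exact hcross q hq p hp
    · rw [indicator_of_notMem (hout p hp), indicator_of_notMem (hout q hq), sub_zero, abs_zero]
      have := K.coe_nonneg
      positivity
  obtain ⟨w, hw, heq⟩ := hlip.extend_real
  refine ⟨_, w, hw, fun p hp => ?_, fun q hq => ?_⟩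
  · rw [← heq (Or.inl hp), indicator_of_mem hp]
  · rw [← heq (Or.inr hq), indicator_of_notMem (hout q hq)]

variable {n m nX nTR : ℕ} {F : EucSp n → EucSp m → EucSp n} {D : Set (EucSp m)}
  {g : Fin nX → EucSp n → ℝ → ℝ} {l : Fin nTR → EucSp n → ℝ} {C L : ℝ}

/-- The value function is uniformly approximated on compact cylinders by polynomials that almost
decrease along the dynamics. -/
lemma RegularData.exists_isPolyFun_near_valueFn (H : RegularData F D g l C L) {T r₀ ε : ℝ}
    (hT : 0 < T) (hr₀ : 0 ≤ r₀) (hε : 0 < ε) :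
    ∃ P : EucSp n → ℝ → ℝ, IsPolyFun P ∧
      (∀ x, ‖x‖ ≤ r₀ → ∀ t ∈ Icc 0 T, |P x t - valueFn F D g l T x t| ≤ ε / 2) ∧
      ∀ x, ‖x‖ ≤ r₀ → ∀ t ∈ Icc 0 T, ∀ d ∈ D,
        deriv (P x) t + ⟪gradient (fun z => P z t) x, F x d⟫ ≤ ε / 2 := by
  obtain ⟨K₁, hK₁, hlip⟩ := H.exists_valueFn_lipschitz (τ := -2) (T := T) (ρ := r₀ + 2)
    (by linarith) (by linarith)
  obtain ⟨K₂, hK₂, hstep⟩ := H.exists_valueFn_step_le (τ := -2) (T := T) (ρ := r₀ + 2)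
    (by linarith) (by linarith)
  obtain ⟨δ, hδ, hδ1, hδε⟩ : ∃ δ : ℝ, 0 < δ ∧ δ ≤ 1 ∧ K₁ * δ ≤ ε / 4 := by
    refine ⟨min 1 (ε / (4 * (K₁ + 1))), by positivity, min_le_left _ _, ?_⟩
    have h := min_le_right 1 (ε / (4 * (K₁ + 1)))
    rw [le_div_iff₀ (by positivity)] at h
    have : 0 ≤ min 1 (ε / (4 * (K₁ + 1))) := by positivity
    nlinarith
  set V := valueFn F D g l T
  set A : Set (EucSp n × ℝ) := Metric.closedBall 0 (r₀ + 2) ×ˢ Icc (-1) (T + δ) with hA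
  have hWlip : LipschitzOnWith (2 * K₁).toNNReal (fun p : EucSp n × ℝ => V p.1 (p.2 - δ)) A := by
    refine LipschitzOnWith.of_le_add_mul _ fun p hp q hq => ?_
    rw [hA, mem_prod, mem_closedBall_zero_iff] at hp hq
    have h := hlip (p.2 - δ) ⟨by linarith [hp.2.1], by linarith [hp.2.2]⟩
      (q.2 - δ) ⟨by linarith [hq.2.1], by linarith [hq.2.2]⟩ p.1 q.1 hp.1 hq.1
    rw [sub_sub_sub_cancel_right] at h
    have h1 : ‖p.1 - q.1‖ ≤ dist p q := by
      rw [← dist_eq_norm, Prod.dist_eq]; exact le_max_left _ _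
    have h2 : |p.2 - q.2| ≤ dist p q := by
      rw [← Real.dist_eq, Prod.dist_eq]; exact le_max_right _ _
    rw [Real.coe_toNNReal _ (by positivity)]
    nlinarith
  have hAsub : A ⊆ Metric.closedBall 0 (r₀ + T + 3) := by
    intro p hp
    rw [hA, mem_prod, mem_closedBall_zero_iff] at hp
    rw [mem_closedBall_zero_iff, Prod.norm_def, max_le_iff, Real.norm_eq_abs, abs_le]
    exact ⟨by linarith [hp.1], by linarith [hp.2.1], by linarith [hp.2.2]⟩
  obtain ⟨K, w, hw, hwA, hsupp⟩ := hWlip.exists_extension_bounded_support hAsub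
  set M := C * (r₀ + 1) with hM
  have hM0 : 0 ≤ M := mul_nonneg H.C_nonneg (by linarith)
  have hL := H.L_nonneg
  set C' := K₂ * (L + 1) + K * (M + 1) * (2 / δ) with hC'
  have hC'0 : 0 ≤ C' := by positivity
  obtain ⟨η, hη, hη1, hη2⟩ : ∃ η : ℝ, 0 < η ∧ K * η ≤ ε / 4 ∧ C' * η ≤ ε / 4 := by
    have hpos : 0 < 4 * (K + C' + 1) := by positivity
    refine ⟨ε / (4 * (K + C' + 1)), by positivity, ?_, ?_⟩ <;>
    · rw [← mul_div_assoc, div_le_div_iff₀ hpos (by norm_num)]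
      nlinarith [mul_nonneg hε.le hC'0, mul_nonneg hε.le K.coe_nonneg]
  obtain ⟨P, hP, hPw, hPder⟩ := exists_isPolyFun_smoothing hw (r := r₀ + T) (by positivity)
    (by positivity) hsupp hη
  have hnorm : ∀ x : EucSp n, ‖x‖ ≤ r₀ → ∀ t ∈ Icc 0 T, ‖(x, t)‖ ≤ r₀ + T := by
    intro x hx t ht
    rw [Prod.norm_def, max_le_iff, Real.norm_eq_abs, abs_of_nonneg ht.1]
    exact ⟨by linarith, by linarith [ht.2]⟩
  refine ⟨P, hP, fun x hx t ht => ?_, fun x hx t ht d hd => ?_⟩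
  · have h1 := hPw (x, t) (hnorm x hx t ht)
    have hmem : (x, t) ∈ A :=
      ⟨by rw [mem_closedBall_zero_iff]; linarith, by linarith [ht.1], by linarith [ht.2]⟩
    rw [hwA hmem] at h1
    have ht1 : t - δ ∈ Icc (-2) T := ⟨by linarith [ht.1], by linarith [ht.2]⟩
    have ht2 : t ∈ Icc (-2) T := ⟨by linarith [ht.1], ht.2⟩
    have hx2 : ‖x‖ ≤ r₀ + 2 := by linarith
    have h2 := hlip t ht2 (t - δ) ht1 x x hx2 hx2
    have h3 := hlip (t - δ) ht1 t ht2 x x hx2 hx2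
    rw [sub_self, norm_zero, zero_add] at h2 h3
    rw [sub_sub_cancel, abs_of_pos hδ] at h2
    rw [sub_sub_cancel_left, abs_neg, abs_of_pos hδ] at h3
    rw [abs_le] at h1 ⊢
    simp only at h1
    constructor <;> linarith [h1.1, h1.2]
  · set v := F x d with hv
    have hvM : ‖v‖ ≤ M := (H.growth x d hd).trans
      (mul_le_mul_of_nonneg_left (by linarith) H.C_nonneg)
    refine (hPder (x, t) v C' (min (δ / 2) (1 / (M + 1))) (hnorm x hx t ht) (by positivity) hC'0
      fun q h hh hh₀ => ?_).trans (by linarith)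
    have hhδ : h < δ / 2 := hh₀.trans_le (min_le_left _ _)
    have hhv : h * ‖v‖ ≤ 1 := by
      have := hh₀.trans_le (min_le_right _ _)
      rw [lt_div_iff₀ (by positivity)] at this
      nlinarith
    rcases le_or_gt ‖q‖ (δ / 2) with hq | hq
    · have hq1 : ‖q.1‖ ≤ ‖q‖ := norm_fst_le q
      have hq2 : |q.2| ≤ ‖q‖ := norm_snd_le q
      have hq3 := abs_le.1 (hq2.trans hq)
      have hx1 : ‖x - q.1‖ ≤ r₀ + 1 := (norm_sub_le _ _).trans (by linarith)
      have hx2 : ‖x - q.1 + h • v‖ ≤ r₀ + 2 := by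
        refine (norm_add_le _ _).trans ?_
        rw [norm_smul, Real.norm_of_nonneg hh.le]
        linarith
      have heq : (x, t) + h • (v, (1 : ℝ)) - q = (x - q.1 + h • v, t + h - q.2) := by
        ext <;> simp; ring
      have hmem₁ : (x - q.1 + h • v, t + h - q.2) ∈ A :=
        ⟨by rwa [mem_closedBall_zero_iff], by linarith [ht.1], by linarith [ht.2]⟩
      have hmem₂ : (x, t) - q ∈ A :=
        ⟨by rw [mem_closedBall_zero_iff, Prod.fst_sub]; linarith,
          by rw [Prod.snd_sub]; linarith [ht.1], by rw [Prod.snd_sub]; linarith [ht.2]⟩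
      rw [heq, hwA hmem₁, hwA hmem₂]
      have hs := hstep (t - q.2 - δ) ⟨by linarith [ht.1], by linarith [ht.2]⟩ h hh.le
        (by linarith [ht.2]) d hd (x - q.1) v (by linarith) hx2
      have hF : ‖v - F (x - q.1) d‖ ≤ L * ‖q‖ := by
        have := H.lip x (x - q.1) d hd
        rw [sub_sub_cancel] at this
        exact this.trans (mul_le_mul_of_nonneg_left hq1 hL)
      have htime : t + h - q.2 - δ = t - q.2 - δ + h := by ring
      simp only [Prod.fst_sub, Prod.snd_sub, htime]
      refine hs.trans (add_le_add_right (mul_le_mul_of_nonneg_left ?_ hh.le) _)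
      have hK₂C : K₂ * L ≤ C' := by
        rw [hC']; nlinarith [show 0 ≤ K * (M + 1) * (2 / δ) by positivity]
      have hK₂C' : K₂ ≤ C' := by
        rw [hC']; nlinarith [show 0 ≤ K * (M + 1) * (2 / δ) by positivity, mul_nonneg hK₂ hL]
      refine add_le_add ?_ (mul_le_mul_of_nonneg_right hK₂C' hh.le)
      calc K₂ * ‖v - F (x - q.1) d‖ ≤ K₂ * (L * ‖q‖) := mul_le_mul_of_nonneg_left hF hK₂
        _ = K₂ * L * ‖q‖ := by ring
        _ ≤ C' * ‖q‖ := mul_le_mul_of_nonneg_right hK₂C (norm_nonneg _)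
    · have hd := hw.dist_le_mul ((x, t) + h • (v, 1) - q) ((x, t) - q)
      have hdist : dist ((x, t) + h • (v, (1 : ℝ)) - q) ((x, t) - q) ≤ h * (M + 1) := by
        rw [dist_eq_norm, sub_sub_sub_cancel_right, add_sub_cancel_left, norm_smul,
          Real.norm_of_nonneg hh.le, Prod.norm_def, norm_one]
        exact mul_le_mul_of_nonneg_left (max_le (by linarith) (by linarith)) hh.le
      have h1 : 1 ≤ 2 / δ * ‖q‖ := by
        rw [div_mul_eq_mul_div, le_div_iff₀ hδ]; linarith
      have h2 : (K : ℝ) * (M + 1) ≤ C' * ‖q‖ := by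
        calc (K : ℝ) * (M + 1) ≤ K * (M + 1) * (2 / δ * ‖q‖) :=
              le_mul_of_one_le_right (by positivity) h1
          _ = K * (M + 1) * (2 / δ) * ‖q‖ := by ring
          _ ≤ C' * ‖q‖ := mul_le_mul_of_nonneg_right
              (by rw [hC']; linarith [show 0 ≤ K₂ * (L + 1) by positivity]) (norm_nonneg _)
      rw [Real.dist_eq] at hd
      have h3 := (le_abs_self _).trans
        (hd.trans (mul_le_mul_of_nonneg_left hdist K.coe_nonneg))
      have h4 := mul_le_mul_of_nonneg_left h2 hh.le
      have h5 : 0 ≤ h * (C' * h) := by positivity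
      linarith

/-- Adding a strictly decreasing affine function of time turns the approximation of the value
function into a strictly feasible one. -/
lemma RegularData.exists_isPolyFun_strict (H : RegularData F D g l C L) {T r₀ ε : ℝ}
    (hT : 0 < T) (hr₀ : 0 ≤ r₀) (hε : 0 < ε) :
    ∃ ψ : EucSp n → ℝ → ℝ, IsPolyFun ψ ∧
      (∀ x, ‖x‖ ≤ r₀ → ∀ t ∈ Icc 0 T,
        valueFn F D g l T x t < ψ x t ∧ ψ x t - valueFn F D g l T x t < (T + 3) * ε) ∧
      ∀ x, ‖x‖ ≤ r₀ → ∀ t ∈ Icc 0 T, ∀ d ∈ D,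
        deriv (ψ x) t + ⟪gradient (fun z => ψ z t) x, F x d⟫ < 0 := by
  obtain ⟨P, hP, hPV, hPder⟩ := H.exists_isPolyFun_near_valueFn hT hr₀ hε
  have hψ : IsPolyFun fun x t => P x t + ((-ε) * t + (ε * T + 2 * ε)) :=
    hP.add (((IsPolyFun.const _).mul IsPolyFun.time).add (IsPolyFun.const _))
  refine ⟨_, hψ, fun x hx t ht => ?_, fun x hx t ht d hd => ?_⟩
  · have h := abs_le.1 (hPV x hx t ht)
    have h1 : 0 ≤ ε * (T - t) := mul_nonneg hε.le (by linarith [ht.2])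
    have h2 : 0 ≤ ε * t := mul_nonneg hε.le ht.1
    constructor <;> nlinarith
  · have h1 := hψ.hasDerivAt_line x (F x d) t
    have h2 : HasDerivAt (fun s : ℝ => (-ε) * (t + s) + (ε * T + 2 * ε)) (-ε) 0 := by
      simpa using (((hasDerivAt_id (0 : ℝ)).const_add t).const_mul (-ε)).add_const (ε * T + 2 * ε)
    have h3 := h1.unique ((hP.hasDerivAt_line x (F x d) t).add h2)
    rw [h3]
    linarith [hPder x hx t ht d hd]

end Approximation

/-- In the polynomial setting, for every `ε > 0` there is a polynomial
`ψ` dominating `u`, `(T+3)ε`-uniformly close to `u` on `B × [0, T]`, and strictly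
feasible for the decrease and domination constraints; consequently there is a sequence
of such polynomials converging to `u` uniformly on `B × [0, T]`. -/
theorem stmt12
    {n m nX nTR : ℕ} (hn : 0 < n) (hm : 0 < m) (hnX : 0 < nX) (hnTR : 0 < nTR)
    (T : ℝ) (hT : 0 < T)
    (D : Set (EucSp m)) (hDne : D.Nonempty) (hDcomp : IsCompact D)
    (F : EucSp n → EucSp m → EucSp n)
    (hFcont : Continuous fun p : EucSp n × EucSp m => F p.1 p.2)
    (LF : ℝ) (hLF : 0 ≤ LF)
    (hFlip : ∀ x y : EucSp n, ∀ d ∈ D, ‖F x d - F y d‖ ≤ LF * ‖x - y‖)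
    (g : Fin nX → EucSp n → ℝ → ℝ) (l : Fin nTR → EucSp n → ℝ)
    (hg : ∀ i, LocallyLipschitz fun p : EucSp n × ℝ => g i p.1 p.2)
    (hl : ∀ j, LocallyLipschitz (l j))
    (u : EucSp n → ℝ → ℝ) (hu : IsValueFun F D g l T u)
    (f : EucSp n → EucSp m → EucSp n)
    (hfcont : Continuous fun p : EucSp n × EucSp m => f p.1 p.2)
    (hflip : ∀ K : Set (EucSp n), IsCompact K → ∃ L, 0 ≤ L ∧
      ∀ x ∈ K, ∀ y ∈ K, ∀ d ∈ D, ‖f x d - f y d‖ ≤ L * ‖x - y‖)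
    (R : ℝ) (hR : 0 < R)
    (Bset : Set (EucSp n)) (hB : Bset = {x : EucSp n | ∑ i, x i ^ 2 ≤ R})
    (hFf : ∀ x ∈ Bset, ∀ d ∈ D, F x d = f x d)
    (hXB : ∀ t ∈ Set.Icc (0:ℝ) T, {x : EucSp n | ∀ i, g i x t ≤ 0} ⊆ Bset)
    (hTRB : {x : EucSp n | ∀ j, l j x ≤ 0} ⊆ Bset)
    (hfpoly : ∃ p : Fin n → MvPolynomial (Fin n ⊕ Fin m) ℝ,
      ∀ (x : EucSp n) (d : EucSp m) (i : Fin n),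
        f x d i = MvPolynomial.eval (Sum.elim (fun k => x k) (fun k => d k)) (p i))
    (hgpoly : ∀ i, ∃ p : MvPolynomial (Fin n ⊕ Unit) ℝ,
      ∀ (x : EucSp n) (t : ℝ),
        g i x t = MvPolynomial.eval (Sum.elim (fun k => x k) (fun _ => t)) p)
    (hlpoly : ∀ j, ∃ p : MvPolynomial (Fin n) ℝ,
      ∀ x : EucSp n, l j x = MvPolynomial.eval (fun k => x k) p) :
    (∀ ε : ℝ, 0 < ε → ∃ ψ : EucSp n → ℝ → ℝ, IsPolyFun ψ ∧
      (∀ x ∈ Bset, ∀ t ∈ Set.Icc (0:ℝ) T,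
        u x t ≤ ψ x t ∧ |ψ x t - u x t| < (T + 3) * ε) ∧
      (∀ x ∈ Bset, ∀ t ∈ Set.Icc (0:ℝ) T, ∀ d ∈ D,
        deriv (ψ x) t + ⟪gradient (fun z => ψ z t) x, f x d⟫ < 0) ∧
      (∀ x ∈ Bset, ∀ t ∈ Set.Icc (0:ℝ) T, ∀ i, g i x t < ψ x t) ∧
      (∀ x ∈ Bset, ∀ j, l j x < ψ x T)) ∧
    (∃ Ψ : ℕ → EucSp n → ℝ → ℝ, (∀ k, IsPolyFun (Ψ k)) ∧
      (∀ k, (∀ x ∈ Bset, ∀ t ∈ Set.Icc (0:ℝ) T, ∀ d ∈ D,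
          deriv (Ψ k x) t + ⟪gradient (fun z => Ψ k z t) x, f x d⟫ < 0) ∧
        (∀ x ∈ Bset, ∀ t ∈ Set.Icc (0:ℝ) T, ∀ i, g i x t < Ψ k x t) ∧
        (∀ x ∈ Bset, ∀ j, l j x < Ψ k x T)) ∧
      TendstoUniformlyOn (fun k (p : EucSp n × ℝ) => Ψ k p.1 p.2)
        (fun p : EucSp n × ℝ => u p.1 p.2) atTop (Bset ×ˢ Set.Icc (0:ℝ) T)) := by
  have hnorm : ∀ x ∈ Bset, ‖x‖ ≤ √R := by
    intro x hx
    rw [hB, mem_ofPred_eq, ← EuclideanSpace.real_norm_sq_eq] at hx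
    exact Real.le_sqrt_of_sq_le hx
  obtain ⟨C₀, hC₀⟩ := hDcomp.exists_bound_of_continuousOn (f := fun d => F 0 d)
    (hFcont.comp (Continuous.prodMk_right 0)).continuousOn
  have hLC : LF ≤ max LF C₀ := le_max_left _ _
  have H : RegularData F D g l (max LF C₀) LF :=
    { nX_pos := hnX
      nTR_pos := hnTR
      nonempty := hDne
      cont := hFcont
      C_nonneg := hLF.trans hLC
      growth := norm_le_linear_growth hLC (fun d hd => (hC₀ d hd).trans (le_max_right _ _)) hFlip
      L_nonneg := hLF
      lip := hFlip
      lip_g := hg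
      lip_l := hl }
  have hmain : ∀ ε : ℝ, 0 < ε → ∃ ψ : EucSp n → ℝ → ℝ, IsPolyFun ψ ∧
      (∀ x ∈ Bset, ∀ t ∈ Set.Icc (0:ℝ) T,
        u x t ≤ ψ x t ∧ |ψ x t - u x t| < (T + 3) * ε) ∧
      (∀ x ∈ Bset, ∀ t ∈ Set.Icc (0:ℝ) T, ∀ d ∈ D,
        deriv (ψ x) t + ⟪gradient (fun z => ψ z t) x, f x d⟫ < 0) ∧
      (∀ x ∈ Bset, ∀ t ∈ Set.Icc (0:ℝ) T, ∀ i, g i x t < ψ x t) ∧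
      (∀ x ∈ Bset, ∀ j, l j x < ψ x T) := by
    intro ε hε
    obtain ⟨ψ, hψ, hψV, hψder⟩ := H.exists_isPolyFun_strict hT (Real.sqrt_nonneg R) hε
    refine ⟨ψ, hψ, fun x hx t ht => ?_, fun x hx t ht d hd => ?_, fun x hx t ht i => ?_,
      fun x hx j => ?_⟩
    · have huV : u x t = valueFn F D g l T x t := hu x t ht
      obtain ⟨h1, h2⟩ := hψV x (hnorm x hx) t ht
      rw [huV, abs_of_pos (sub_pos.2 h1)]
      exact ⟨h1.le, h2⟩
    · rw [← hFf x hx d hd]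
      exact hψder x (hnorm x hx) t ht d hd
    · exact (H.constraint_le_valueFn ht.2 x i).trans_lt (hψV x (hnorm x hx) t ht).1
    · exact (H.target_le_valueFn T x j).trans_lt (hψV x (hnorm x hx) T ⟨hT.le, le_rfl⟩).1
  refine ⟨hmain, ?_⟩
  choose Ψ hΨ using fun k : ℕ => hmain (1 / ((T + 3) * ((k : ℝ) + 1))) (by positivity)
  refine ⟨Ψ, fun k => (hΨ k).1, fun k => (hΨ k).2.2, ?_⟩
  rw [Metric.tendstoUniformlyOn_iff]
  intro ε hε
  filter_upwards [tendsto_one_div_add_atTop_nhds_zero_nat.eventually (gt_mem_nhds hε)]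
    with k hk p hp
  have h := ((hΨ k).2.1 p.1 hp.1 p.2 hp.2).2
  have heq : (T + 3) * (1 / ((T + 3) * ((k : ℝ) + 1))) = 1 / ((k : ℝ) + 1) := by field_simp
  rw [heq] at h
  rw [dist_comm, Real.dist_eq]
  exact h.trans hk

end
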